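/- arXiv:2405.07996 — 13 statements merged into one kernel-verified Lean document; each statement's English description precedes it below -/
import Mathlib

section
/- If every component F_i of F is convex and x* ∈ ℝ^n is a Pareto critical point, then x* is a weakly Pareto solution. -/
open RealInnerProductSpace

/-- If every component `F_i` of `F` is convex and `x*` is a Pareto critical
point, then `x*` is a weakly Pareto solution. -/
theorem pareto_critical_implies_weakly_pareto_of_convex {n m : ℕ}
    (F : Fin m → EuclideanSpace ℝ (Fin n) → ℝ)
    (hF : ∀ i, ContDiff ℝ 1 (F i))
    (hconv : ∀ i, ConvexOn ℝ Set.univ (F i))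
    (xstar : EuclideanSpace ℝ (Fin n))
    (hcrit : ¬ ∃ d : EuclideanSpace ℝ (Fin n), ∀ i, ⟪gradient (F i) xstar, d⟫ < 0) :
    ¬ ∃ x : EuclideanSpace ℝ (Fin n), ∀ i, F i x < F i xstar := by
  rintro ⟨x, hx⟩
  refine hcrit ⟨x - xstar, fun i => ?_⟩
  have hd : DifferentiableAt ℝ (F i) xstar := ((hF i).differentiable one_ne_zero) xstar
  have hc : ConvexOn ℝ Set.univ (F i ∘ (AffineMap.lineMap xstar x : ℝ →ᵃ[ℝ] _)) := by
    simpa using (hconv i).comp_affineMap (AffineMap.lineMap xstar x : ℝ →ᵃ[ℝ] _)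
  have hl : HasDerivAt (AffineMap.lineMap xstar x : ℝ → EuclideanSpace ℝ (Fin n))
      (x - xstar) 0 := AffineMap.hasDerivAt_lineMap
  have hg : HasFDerivAt (F i) (fderiv ℝ (F i) xstar)
      ((AffineMap.lineMap xstar x : ℝ → EuclideanSpace ℝ (Fin n)) 0) := by
    simpa using hd.hasFDerivAt
  have h := hc.le_slope_of_hasDerivAt (Set.mem_univ 0) (Set.mem_univ 1) one_pos
    (hg.comp_hasDerivAt 0 hl)
  simp [slope_def_field] at h
  have e : ⟪gradient (F i) xstar, x - xstar⟫ = fderiv ℝ (F i) xstar (x - xstar) := by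
    simp only [gradient, InnerProductSpace.toDual_symm_apply]
  rw [e, map_sub]
  have := hx i
  linarith
end

section
/- If every component F_i of F is strictly convex and x* ∈ ℝ^n is a Pareto critical point, then x* is a Pareto solution. -/
open RealInnerProductSpace

/-- If every component `F_i` of `F` is strictly convex and `x*` is a Pareto
critical point, then `x*` is a Pareto solution: there is no `x` with `F_i(x) ≤ F_i(x*)` for
all `i` and `F(x) ≠ F(x*)`. -/
theorem pareto_critical_implies_pareto_of_strictConvex {n m : ℕ}
    (F : Fin m → EuclideanSpace ℝ (Fin n) → ℝ)
    (hF : ∀ i, ContDiff ℝ 1 (F i))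
    (hconv : ∀ i, StrictConvexOn ℝ Set.univ (F i))
    (xstar : EuclideanSpace ℝ (Fin n))
    (hcrit : ¬ ∃ d : EuclideanSpace ℝ (Fin n), ∀ i, ⟪gradient (F i) xstar, d⟫ < 0) :
    ¬ ∃ x : EuclideanSpace ℝ (Fin n),
      (∀ i, F i x ≤ F i xstar) ∧ (fun i => F i x) ≠ (fun i => F i xstar) := by
  rintro ⟨x, hle, hne⟩
  have hx : xstar ≠ x := by
    rintro rfl
    exact hne rfl
  apply hcrit
  refine ⟨x - xstar, fun i => ?_⟩
  have hinj : Function.Injective (AffineMap.lineMap xstar x : ℝ →ᵃ[ℝ] _) :=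
    AffineMap.lineMap_injective ℝ hx
  have hg : StrictConvexOn ℝ Set.univ (fun t : ℝ => F i (AffineMap.lineMap xstar x t)) := by
    refine ⟨convex_univ, fun s _ t _ hst a b ha hb hab => ?_⟩
    have h := (hconv i).2 (Set.mem_univ (AffineMap.lineMap xstar x s))
      (Set.mem_univ (AffineMap.lineMap xstar x t)) (hinj.ne hst) ha hb hab
    have e := Convex.combo_affine_apply (f := (AffineMap.lineMap xstar x : ℝ →ᵃ[ℝ] _))
      (x := s) (y := t) hab
    rw [← e] at h
    exact h
  have hd : DifferentiableAt ℝ (F i) xstar := (hF i).differentiable (by norm_num) xstar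
  have hd0 : HasFDerivAt (F i) (fderiv ℝ (F i) xstar)
      ((AffineMap.lineMap xstar x : ℝ →ᵃ[ℝ] _) 0) := by
    rw [AffineMap.lineMap_apply_zero]
    exact hd.hasFDerivAt
  have hder : HasDerivAt (fun t : ℝ => F i (AffineMap.lineMap xstar x t))
      (fderiv ℝ (F i) xstar (x - xstar)) 0 :=
    hd0.comp_hasDerivAt (0 : ℝ) AffineMap.hasDerivAt_lineMap
  have key := hg.lt_slope_of_hasDerivAt (Set.mem_univ 0) (Set.mem_univ 1) zero_lt_one hder
  simp only [slope_def_field, AffineMap.lineMap_apply_zero, AffineMap.lineMap_apply_one,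
    sub_zero, div_one] at key
  have hgr : ⟪gradient (F i) xstar, x - xstar⟫ = fderiv ℝ (F i) xstar (x - xstar) := by
    simp [gradient]
  rw [hgr]
  linarith [hle i]
end

section
/- Let x ∈ ℝ^n be such that the level set {y ∈ ℝ^n : F_i(y) ≤ F_i(x) for all i} is compact, let ᾱ ∈ ℝ^m have positive entries, let d ∈ ℝ^n satisfy D_ᾱ(x,d) < 0, and let 0 < σ₁ ≤ σ₂ < 1. Then there exist 0 < t_l < t_u such that every t ∈ [t_l, t_u] satisfies both Wolfe conditions: (F_i(x+td) − F_i(x))/ᾱ_i ≤ σ₁ t D_ᾱ(x,d) for all i ∈ {1,…,m}, and D_ᾱ(x+td, d) ≥ σ₂ D_ᾱ(x,d). -/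
open RealInnerProductSpace

/-- `D_α(x,d) = max_{i} ⟪∇F_i(x), d⟫ / α_i`. -/
noncomputable def Dval {n m : ℕ} [NeZero m] (F : Fin m → EuclideanSpace ℝ (Fin n) → ℝ)
    (α : Fin m → ℝ) (x d : EuclideanSpace ℝ (Fin n)) : ℝ :=
  Finset.univ.sup' Finset.univ_nonempty fun i => ⟪gradient (F i) x, d⟫ / α i

/-- existence of an interval of stepsizes satisfying both Wolfe conditions. -/
theorem wolfe_interval_exists {n m : ℕ} [NeZero m]
    (F : Fin m → EuclideanSpace ℝ (Fin n) → ℝ)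
    (hF : ∀ i, ContDiff ℝ 1 (F i))
    (x : EuclideanSpace ℝ (Fin n))
    (hlevel : IsCompact {y : EuclideanSpace ℝ (Fin n) | ∀ i, F i y ≤ F i x})
    (αb : Fin m → ℝ) (hαb : ∀ i, 0 < αb i)
    (d : EuclideanSpace ℝ (Fin n)) (hd : Dval F αb x d < 0)
    (σ₁ σ₂ : ℝ) (hσ₁ : 0 < σ₁) (hσ₁₂ : σ₁ ≤ σ₂) (hσ₂ : σ₂ < 1) :
    ∃ tl tu : ℝ, 0 < tl ∧ tl < tu ∧ ∀ t ∈ Set.Icc tl tu,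
      (∀ i, (F i (x + t • d) - F i x) / αb i ≤ σ₁ * t * Dval F αb x d) ∧
      σ₂ * Dval F αb x d ≤ Dval F αb (x + t • d) d := by
  set D := Dval F αb x d with hD
  have hDi : ∀ y i, ⟪gradient (F i) y, d⟫ / αb i ≤ Dval F αb y d := fun y i =>
    Finset.le_sup' (f := fun i => ⟪gradient (F i) y, d⟫ / αb i) (Finset.mem_univ i)
  have hd0 : d ≠ 0 := by
    rintro rfl
    have := hDi x 0
    rw [inner_zero_right, zero_div] at this
    linarith
  set g : Fin m → ℝ → ℝ := fun i t => (F i (x + t • d) - F i x) / αb i - σ₁ * t * D with hg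
  set g' : Fin m → ℝ → ℝ := fun i t => ⟪gradient (F i) (x + t • d), d⟫ / αb i - σ₁ * D with hg'
  have hder : ∀ i t, HasDerivAt (g i) (g' i t) t := by
    intro i t
    have h1 : HasFDerivAt (F i) (fderiv ℝ (F i) (x + t • d)) (x + t • d) :=
      ((hF i).differentiable one_ne_zero _).hasFDerivAt
    have h2 : HasDerivAt (fun s : ℝ => x + s • d) d t := by
      simpa using ((hasDerivAt_id t).smul_const d).const_add x
    have h3 := h1.comp_hasDerivAt t h2
    have h4 : fderiv ℝ (F i) (x + t • d) d = ⟪gradient (F i) (x + t • d), d⟫ := by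
      simp [gradient]
    rw [h4] at h3
    have h5 : HasDerivAt (fun s : ℝ => σ₁ * s * D) (σ₁ * D) t := by
      simpa using ((hasDerivAt_id t).const_mul σ₁).mul_const D
    exact ((h3.sub_const (F i x)).div_const (αb i)).sub h5
  have hcont : ∀ i, Continuous (g i) := fun i =>
    continuous_iff_continuousAt.2 fun t => (hder i t).continuousAt
  have hcont' : ∀ i, Continuous (g' i) := by
    intro i
    have h1 : Continuous (fun y => gradient (F i) y) := by
      unfold gradient
      exact (LinearIsometryEquiv.continuous _).comp ((hF i).continuous_fderiv one_ne_zero)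
    have h2 : Continuous (fun t : ℝ => x + t • d) := by fun_prop
    exact (((h1.comp h2).inner continuous_const).div_const _).sub continuous_const
  have hg0 : ∀ i, g i 0 = 0 := by intro i; simp [hg]
  have hg'0 : ∀ i, g' i 0 < 0 := by
    intro i
    have h1 := hDi x i
    simp only [hg', zero_smul, add_zero]
    nlinarith
  have hev : ∀ᶠ t in nhdsWithin (0:ℝ) (Set.Ioi 0), ∀ i, g i t < 0 := by
    rw [Filter.eventually_all]
    intro i
    have h1 := (hder i 0).tendsto_slope_zero_right
    filter_upwards [h1.eventually_lt_const (hg'0 i), self_mem_nhdsWithin] with t ht ht0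
    have ht0 : 0 < t := ht0
    rw [zero_add, hg0, sub_zero, smul_eq_mul] at ht
    by_contra hc
    push Not at hc
    have : 0 ≤ t⁻¹ * g i t := by positivity
    linarith
  obtain ⟨ε, hε, hεg⟩ := mem_nhdsGT_iff_exists_Ioo_subset.1 hev
  have hε : 0 < ε := hε
  set S : Set ℝ := Set.Ici ε ∩ ⋃ i, {t | 0 ≤ g i t} with hS
  have hSc : IsClosed S :=
    isClosed_Ici.inter (isClosed_iUnion_of_finite fun i => isClosed_le continuous_const (hcont i))
  have hSne : S.Nonempty := by
    by_contra hne
    obtain ⟨R, hR⟩ := hlevel.isBounded.exists_norm_le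
    have hdn : 0 < ‖d‖ := norm_pos_iff.2 hd0
    have key : ∀ t, ε ≤ t → t * ‖d‖ ≤ R + ‖x‖ := by
      intro t ht
      have hmem : x + t • d ∈ {y : EuclideanSpace ℝ (Fin n) | ∀ i, F i y ≤ F i x} := by
        intro i
        by_contra hc
        push Not at hc
        apply hne
        refine ⟨t, ht, Set.mem_iUnion.2 ⟨i, ?_⟩⟩
        have h1 : 0 ≤ (F i (x + t • d) - F i x) / αb i :=
          div_nonneg (by linarith) (hαb i).le
        have h2 : 0 ≤ σ₁ * t * (-D) :=
          mul_nonneg (mul_nonneg hσ₁.le (by linarith)) (by linarith)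
        show 0 ≤ (F i (x + t • d) - F i x) / αb i - σ₁ * t * D
        linarith
      have h1 := hR _ hmem
      have h2 : ‖t • d‖ ≤ ‖x + t • d‖ + ‖x‖ := by
        have := norm_sub_le (x + t • d) x
        rwa [add_sub_cancel_left] at this
      rw [norm_smul, Real.norm_eq_abs, abs_of_pos (by linarith)] at h2
      linarith
    have h1 := key ε le_rfl
    have h2 := key (ε + (R + ‖x‖ + 1) / ‖d‖) (by
      have : 0 ≤ (R + ‖x‖ + 1) / ‖d‖ := div_nonneg (by nlinarith) hdn.le
      linarith)
    rw [add_mul, div_mul_cancel₀ _ hdn.ne'] at h2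
    nlinarith
  have hSb : BddBelow S := ⟨ε, fun t ht => ht.1⟩
  have hTS := hSc.csInf_mem hSne hSb
  set T := sInf S
  have hlt : ∀ t, 0 < t → t < T → ∀ i, g i t < 0 := by
    intro t h0 hT i
    by_cases h : t < ε
    · exact hεg ⟨h0, h⟩ i
    · by_contra hc
      push Not at hc h
      exact absurd (csInf_le hSb (show t ∈ S from ⟨h, Set.mem_iUnion.2 ⟨i, hc⟩⟩)) (not_le.2 hT)
  have hT0 : 0 < T := lt_of_lt_of_le hε hTS.1
  obtain ⟨i, hi⟩ := Set.mem_iUnion.1 hTS.2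
  have hi : 0 ≤ g i T := hi
  obtain ⟨c, hc, hce⟩ := exists_hasDerivAt_eq_slope (g i) (g' i) (show T / 2 < T by linarith)
    (hcont i).continuousOn (fun t _ => hder i t)
  have hcpos : 0 < g' i c := by
    rw [hce]
    exact div_pos (by linarith [hlt (T / 2) (by linarith) (by linarith) i]) (by linarith)
  have hnb : ∀ᶠ t in nhds c, 0 < g' i t ∧ t < T :=
    ((hcont' i).continuousAt.eventually_const_lt hcpos).and (eventually_lt_nhds hc.2)
  obtain ⟨δ, hδ, hδs⟩ := Metric.eventually_nhds_iff.1 hnb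
  have hc0 : 0 < c := by linarith [hc.1]
  refine ⟨c, c + δ / 2, hc0, by linarith, ?_⟩
  rintro t ⟨ht1, ht2⟩
  obtain ⟨hp, hT⟩ := hδs (show dist t c < δ by
    rw [Real.dist_eq, abs_of_nonneg (by linarith)]; linarith)
  constructor
  · intro j
    have h : (F j (x + t • d) - F j x) / αb j - σ₁ * t * D < 0 := hlt t (by linarith) hT j
    linarith
  · have h1 := hDi (x + t • d) i
    have h2 : 0 < ⟪gradient (F i) (x + t • d), d⟫ / αb i - σ₁ * D := hp
    nlinarith
end

section
/- Under the stated subspace-minimization setup, the direction d = μ* v + ν* s satisfies the sufficient descent condition D_ᾱ(x,d) ≤ −(c₁/2)‖d‖². -/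
open RealInnerProductSpace Matrix

/-- Objective of the Barzilai–Borwein direction subproblem:
`w ↦ max_i ⟪∇F_i(x), w⟫/α_i + ½‖w‖²`. -/
noncomputable def bbObj {n m : ℕ} [NeZero m] (F : Fin m → EuclideanSpace ℝ (Fin n) → ℝ)
    (α : Fin m → ℝ) (x w : EuclideanSpace ℝ (Fin n)) : ℝ :=
  (Finset.univ.sup' Finset.univ_nonempty fun i => ⟪gradient (F i) x, w⟫ / α i)
    + (1 / 2) * ‖w‖ ^ 2

/-- The two-dimensional subspace model
`φ(μ,ν) = max_i [ μ⟪∇F_i(x), v⟫/ᾱ_i + ν⟪∇F_i(x), s⟫/ᾱ_i ] + ½ (μ,ν) H (μ,ν)ᵀ`. -/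
noncomputable def subModel {n m : ℕ} [NeZero m] (F : Fin m → EuclideanSpace ℝ (Fin n) → ℝ)
    (αb : Fin m → ℝ) (x v s : EuclideanSpace ℝ (Fin n)) (H : Matrix (Fin 2) (Fin 2) ℝ)
    (p : Fin 2 → ℝ) : ℝ :=
  (Finset.univ.sup' Finset.univ_nonempty fun i =>
      p 0 * (⟪gradient (F i) x, v⟫ / αb i) + p 1 * (⟪gradient (F i) x, s⟫ / αb i))
    + (1 / 2) * (p ⬝ᵥ (H *ᵥ p))

/-- the subspace-minimization direction `d = μ* v + ν* s` satisfies the sufficient descent condition `D_ᾱ(x,d) ≤ −(c₁/2)‖d‖²`. -/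
theorem sufficient_descent_of_subspace_minimizer {n m : ℕ} [NeZero m]
    (F : Fin m → EuclideanSpace ℝ (Fin n) → ℝ)
    (hF : ∀ i, ContDiff ℝ 1 (F i))
    (x : EuclideanSpace ℝ (Fin n))
    (α αb : Fin m → ℝ) (hα : ∀ i, 0 < α i) (hαb : ∀ i, 0 < αb i)
    (v : EuclideanSpace ℝ (Fin n))
    (hv : ∀ w, bbObj F α x v ≤ bbObj F α x w) (hv0 : v ≠ 0)
    (s : EuclideanSpace ℝ (Fin n)) (hs0 : s ≠ 0)
    (H : Matrix (Fin 2) (Fin 2) ℝ) (hH : H.IsSymm)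
    (c₁ c₂ : ℝ) (hc₁ : 0 < c₁) (hc₁₂ : c₁ ≤ c₂)
    (hspec : ∀ z : Fin 2 → ℝ,
      c₁ * (z ⬝ᵥ z) ≤
          z ⬝ᵥ ((Matrix.diagonal ![‖v‖⁻¹, ‖s‖⁻¹] * H * Matrix.diagonal ![‖v‖⁻¹, ‖s‖⁻¹]) *ᵥ z) ∧
        z ⬝ᵥ ((Matrix.diagonal ![‖v‖⁻¹, ‖s‖⁻¹] * H * Matrix.diagonal ![‖v‖⁻¹, ‖s‖⁻¹]) *ᵥ z) ≤
          c₂ * (z ⬝ᵥ z))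
    (p : Fin 2 → ℝ)
    (hp : ∀ q : Fin 2 → ℝ, subModel F αb x v s H p ≤ subModel F αb x v s H q)
    (d : EuclideanSpace ℝ (Fin n)) (hd : d = p 0 • v + p 1 • s) :
    Dval F αb x d ≤ -(c₁ / 2) * ‖d‖ ^ 2 := by
  have hvn : ‖v‖ ≠ 0 := norm_ne_zero_iff.mpr hv0
  have hsn : ‖s‖ ≠ 0 := norm_ne_zero_iff.mpr hs0
  have hM : Dval F αb x d = Finset.univ.sup' Finset.univ_nonempty fun i =>
      p 0 * (⟪gradient (F i) x, v⟫ / αb i) + p 1 * (⟪gradient (F i) x, s⟫ / αb i) := by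
    unfold Dval
    congr 1
    funext i
    rw [hd, inner_add_right, inner_smul_right, inner_smul_right]
    ring
  set M := Dval F αb x d with hMdef
  obtain ⟨Q, hQ⟩ : ∃ Q, Q = p ⬝ᵥ (H *ᵥ p) := ⟨_, rfl⟩
  have hQ1 : c₁ * ((p 0 * ‖v‖) ^ 2 + (p 1 * ‖s‖) ^ 2) ≤ Q := by
    have h := (hspec ![‖v‖ * p 0, ‖s‖ * p 1]).1
    have e : (Matrix.diagonal ![‖v‖⁻¹, ‖s‖⁻¹] * H * Matrix.diagonal ![‖v‖⁻¹, ‖s‖⁻¹]) *ᵥ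
        ![‖v‖ * p 0, ‖s‖ * p 1] = Matrix.diagonal ![‖v‖⁻¹, ‖s‖⁻¹] *ᵥ (H *ᵥ p) := by
      rw [← Matrix.mulVec_mulVec, ← Matrix.mulVec_mulVec]
      congr 2
      ext i
      fin_cases i <;> simp [Matrix.mulVec_diagonal, hvn, hsn]
    rw [e] at h
    have e2 : ![‖v‖ * p 0, ‖s‖ * p 1] ⬝ᵥ (Matrix.diagonal ![‖v‖⁻¹, ‖s‖⁻¹] *ᵥ (H *ᵥ p)) = Q := by
      rw [hQ]
      generalize H *ᵥ p = y
      simp only [dotProduct, Fin.sum_univ_two, Matrix.mulVec_diagonal]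
      simp
      field_simp
    rw [e2] at h
    simp only [dotProduct, Fin.sum_univ_two, Matrix.cons_val_zero, Matrix.cons_val_one] at h
    linarith
  have hdn : ‖d‖ ^ 2 ≤ 2 * ((p 0 * ‖v‖) ^ 2 + (p 1 * ‖s‖) ^ 2) := by
    have h1 : ‖d‖ ≤ |p 0| * ‖v‖ + |p 1| * ‖s‖ := by
      rw [hd]
      refine (norm_add_le _ _).trans ?_
      rw [norm_smul, norm_smul, Real.norm_eq_abs, Real.norm_eq_abs]
    have h2 : ‖d‖ ^ 2 ≤ (|p 0| * ‖v‖ + |p 1| * ‖s‖) ^ 2 :=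
      pow_le_pow_left₀ (norm_nonneg _) h1 2
    have h3 := sq_nonneg (|p 0| * ‖v‖ - |p 1| * ‖s‖)
    have h4 := sq_abs (p 0)
    have h5 := sq_abs (p 1)
    rw [mul_pow, mul_pow, ← h4, ← h5]
    nlinarith
  have hQ0 : 0 ≤ Q := le_trans (by positivity) hQ1
  have key : ∀ t : ℝ, 0 ≤ t → M + 1 / 2 * Q ≤ t * M + 1 / 2 * (t ^ 2 * Q) := by
    intro t ht
    have h := hp (t • p)
    unfold subModel at h
    rw [← hM, ← hQ, Matrix.mulVec_smul, smul_dotProduct, dotProduct_smul, ← hQ] at h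
    refine h.trans ?_
    have : (Finset.univ.sup' Finset.univ_nonempty fun i =>
      (t • p) 0 * (⟪gradient (F i) x, v⟫ / αb i) + (t • p) 1 * (⟪gradient (F i) x, s⟫ / αb i))
        ≤ t * M := by
      apply Finset.sup'_le
      intro i hi
      rw [hM]
      have := Finset.le_sup' (fun i =>
        p 0 * (⟪gradient (F i) x, v⟫ / αb i) + p 1 * (⟪gradient (F i) x, s⟫ / αb i)) hi
      refine le_trans (le_of_eq ?_) (mul_le_mul_of_nonneg_left this ht)
      simp only [Pi.smul_apply, smul_eq_mul]
      ring
    simp only [smul_eq_mul] at *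
    linarith
  have hMQ : M ≤ -Q := by
    by_contra hcon
    push Not at hcon
    have he : 0 < M + Q := by linarith
    have hpos : 0 < Q + (M + Q) := by linarith
    have h := key (Q / (Q + (M + Q))) (by positivity)
    obtain ⟨u, hu⟩ : ∃ u, u = Q / (Q + (M + Q)) := ⟨_, rfl⟩
    rw [← hu] at h
    have hu2 : u * (Q + (M + Q)) = Q := by rw [hu]; field_simp
    have hu1 : u < 1 := by rw [hu, div_lt_one hpos]; linarith
    have h6 : (1 - u) * (M + (1 + u) / 2 * Q) ≤ 0 := by nlinarith
    have h7 : M + (1 + u) / 2 * Q ≤ 0 := by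
      by_contra h8
      push Not at h8
      have := mul_pos (sub_pos.mpr hu1) h8
      linarith
    have hu0 : 0 ≤ u := by rw [hu]; positivity
    nlinarith [mul_nonneg hu0 he.le]
  nlinarith
end

section
/- Under the stated subspace-minimization setup, the direction d = μ* v + ν* s satisfies D_ᾱ(x,d) ≤ −min_{i∈{1,…,m}} (α_i/ᾱ_i)² · ‖v‖²/c₂. -/
open RealInnerProductSpace Matrix

theorem aux_stationary (L Q : ℝ) (h : ∀ t : ℝ, 0 < t → L + 1 / 2 * Q ≤ t * L + 1 / 2 * (t ^ 2 * Q)) :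
    L + Q = 0 := by
  have key : ∀ e : ℝ, -1 < e → 0 ≤ e * (L + Q + e * Q / 2) := by
    intro e he
    have := h (1 + e) (by linarith)
    nlinarith
  have hQ : 0 ≤ |Q| := abs_nonneg Q
  have h1 := neg_abs_le Q
  have h2 := le_abs_self Q
  apply le_antisymm
  · by_contra! hc
    set e := (L + Q) / (L + Q + |Q|) with he
    have hpos : 0 < L + Q + |Q| := by linarith
    have e0 : 0 < e := by positivity
    have e1 : e ≤ 1 := by rw [he, div_le_one hpos]; linarith
    have e2 : e * (L + Q + |Q|) = L + Q := by rw [he]; field_simp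
    have := key (-(e/2)) (by linarith)
    have h3 : 0 < L + Q + (-(e/2)) * Q / 2 := by
      nlinarith [mul_nonneg e0.le (sub_nonneg.2 h2), mul_pos e0 hc]
    nlinarith [mul_pos e0 h3]
  · by_contra! hc
    set a := -(L + Q) with ha
    have ha0 : 0 < a := by linarith
    set e := a / (a + |Q|) with he
    have hpos : 0 < a + |Q| := by linarith
    have e0 : 0 < e := by positivity
    have e2 : e * (a + |Q|) = a := by rw [he]; field_simp
    have := key e (by linarith)
    have h3 : L + Q + e * Q / 2 < 0 := by
      nlinarith [mul_nonneg e0.le (sub_nonneg.2 h2), mul_pos e0 ha0]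
    nlinarith [mul_pos_of_neg_of_neg (neg_neg_of_pos e0) h3]

theorem aux_sup {m : ℕ} [NeZero m] (f g : Fin m → ℝ) (t : ℝ) (ht : 0 < t) (h : ∀ i, g i = t * f i) :
    Finset.univ.sup' Finset.univ_nonempty g ≤ t * Finset.univ.sup' Finset.univ_nonempty f := by
  apply Finset.sup'_le
  intro i _
  rw [h]
  exact mul_le_mul_of_nonneg_left (Finset.le_sup' f (Finset.mem_univ i)) ht.le

/-- the subspace-minimization direction satisfies `D_ᾱ(x,d) ≤ −min_i(α_i/ᾱ_i)²·‖v‖²/c₂`. -/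
theorem descent_bound_of_subspace_minimizer {n m : ℕ} [NeZero m]
    (F : Fin m → EuclideanSpace ℝ (Fin n) → ℝ)
    (hF : ∀ i, ContDiff ℝ 1 (F i))
    (x : EuclideanSpace ℝ (Fin n))
    (α αb : Fin m → ℝ) (hα : ∀ i, 0 < α i) (hαb : ∀ i, 0 < αb i)
    (v : EuclideanSpace ℝ (Fin n))
    (hv : ∀ w, bbObj F α x v ≤ bbObj F α x w) (hv0 : v ≠ 0)
    (s : EuclideanSpace ℝ (Fin n)) (hs0 : s ≠ 0)
    (H : Matrix (Fin 2) (Fin 2) ℝ) (hH : H.IsSymm)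
    (c₁ c₂ : ℝ) (hc₁ : 0 < c₁) (hc₁₂ : c₁ ≤ c₂)
    (hspec : ∀ z : Fin 2 → ℝ,
      c₁ * (z ⬝ᵥ z) ≤
          z ⬝ᵥ ((Matrix.diagonal ![‖v‖⁻¹, ‖s‖⁻¹] * H * Matrix.diagonal ![‖v‖⁻¹, ‖s‖⁻¹]) *ᵥ z) ∧
        z ⬝ᵥ ((Matrix.diagonal ![‖v‖⁻¹, ‖s‖⁻¹] * H * Matrix.diagonal ![‖v‖⁻¹, ‖s‖⁻¹]) *ᵥ z) ≤
          c₂ * (z ⬝ᵥ z))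
    (p : Fin 2 → ℝ)
    (hp : ∀ q : Fin 2 → ℝ, subModel F αb x v s H p ≤ subModel F αb x v s H q)
    (d : EuclideanSpace ℝ (Fin n)) (hd : d = p 0 • v + p 1 • s) :
    Dval F αb x d ≤ -((Finset.univ.inf' Finset.univ_nonempty fun i => (α i / αb i) ^ 2) * ‖v‖ ^ 2 / c₂) := by
  have hvn : 0 < ‖v‖ := norm_pos_iff.2 hv0
  have hc₂ : 0 < c₂ := by linarith
  -- Barzilai-Borwein direction: `max_i ⟪∇F_i, v⟫ / α_i = -‖v‖²`
  have hA : (Finset.univ.sup' Finset.univ_nonempty fun i => ⟪gradient (F i) x, v⟫ / α i)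
      + ‖v‖ ^ 2 = 0 := by
    apply aux_stationary
    intro t ht
    refine (hv (t • v)).trans ?_
    unfold bbObj
    rw [norm_smul, mul_pow, Real.norm_eq_abs, sq_abs]
    have := aux_sup (fun i => ⟪gradient (F i) x, v⟫ / α i)
      (fun i => ⟪gradient (F i) x, t • v⟫ / α i) t ht
      (fun i => by rw [real_inner_smul_right, mul_div_assoc])
    linarith
  -- subspace minimizer
  have hB : (Finset.univ.sup' Finset.univ_nonempty fun i =>
      p 0 * (⟪gradient (F i) x, v⟫ / αb i) + p 1 * (⟪gradient (F i) x, s⟫ / αb i))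
      + (p ⬝ᵥ (H *ᵥ p)) = 0 := by
    apply aux_stationary
    intro t ht
    refine (hp (t • p)).trans ?_
    unfold subModel
    have := aux_sup (fun i =>
        p 0 * (⟪gradient (F i) x, v⟫ / αb i) + p 1 * (⟪gradient (F i) x, s⟫ / αb i))
      (fun i => (t • p) 0 * (⟪gradient (F i) x, v⟫ / αb i)
        + (t • p) 1 * (⟪gradient (F i) x, s⟫ / αb i)) t ht
      (fun i => by simp only [Pi.smul_apply, smul_eq_mul]; ring)
    have h2 : (t • p) ⬝ᵥ (H *ᵥ (t • p)) = t ^ 2 * (p ⬝ᵥ (H *ᵥ p)) := by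
      rw [Matrix.mulVec_smul, dotProduct_smul, smul_dotProduct, smul_eq_mul, smul_eq_mul]; ring
    rw [h2]
    linarith
  have hD : Dval F αb x d = Finset.univ.sup' Finset.univ_nonempty fun i =>
      p 0 * (⟪gradient (F i) x, v⟫ / αb i) + p 1 * (⟪gradient (F i) x, s⟫ / αb i) := by
    unfold Dval
    congr 1
    funext i
    rw [hd, inner_add_right, real_inner_smul_right, real_inner_smul_right]
    ring
  have hH00 : H 0 0 ≤ c₂ * ‖v‖ ^ 2 := by
    have h := (hspec ![‖v‖, 0]).2
    simp [Matrix.mulVec, dotProduct, Fin.sum_univ_two, Matrix.mul_apply, Matrix.diagonal] at h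
    field_simp at h
    nlinarith
  obtain ⟨j, -, hj⟩ := Finset.exists_mem_eq_inf' (Finset.univ_nonempty (α := Fin m))
    (fun i => α i / αb i)
  set r := α j / αb j with hr
  have hr0 : 0 < r := div_pos (hα j) (hαb j)
  have hrle : ∀ i, r ≤ α i / αb i := fun i => by
    rw [← hj]; exact Finset.inf'_le _ (Finset.mem_univ i)
  have hinf : (Finset.univ.inf' Finset.univ_nonempty fun i => (α i / αb i) ^ 2) ≤ r ^ 2 :=
    Finset.inf'_le (fun i => (α i / αb i) ^ 2) (Finset.mem_univ j)
  have hinf' : r ^ 2 ≤ (Finset.univ.inf' Finset.univ_nonempty fun i => (α i / αb i) ^ 2) := by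
    apply Finset.le_inf'
    intro i _
    exact pow_le_pow_left₀ hr0.le (hrle i) 2
  have hi : ∀ i, ⟪gradient (F i) x, v⟫ / αb i ≤ -(r * ‖v‖ ^ 2) := by
    intro i
    have h1 : ⟪gradient (F i) x, v⟫ / α i ≤ -‖v‖ ^ 2 := by
      have := Finset.le_sup' (fun i => ⟪gradient (F i) x, v⟫ / α i) (Finset.mem_univ i)
      linarith
    have h2 : ⟪gradient (F i) x, v⟫ / αb i
        = (α i / αb i) * (⟪gradient (F i) x, v⟫ / α i) := by
      have := (hα i).ne'
      have := (hαb i).ne'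
      field_simp
    rw [h2]
    have h3 : 0 < α i / αb i := div_pos (hα i) (hαb i)
    have h4 := mul_le_mul_of_nonneg_left h1 h3.le
    have h5 := mul_le_mul_of_nonneg_right (hrle i) (sq_nonneg ‖v‖)
    linarith
  have ht : 0 < r / c₂ := div_pos hr0 hc₂
  have hq := hp ![r / c₂, 0]
  have hφ : subModel F αb x v s H ![r / c₂, 0] ≤ -(r ^ 2 * ‖v‖ ^ 2 / c₂) / 2 := by
    unfold subModel
    have h1 : (Finset.univ.sup' Finset.univ_nonempty fun i =>
        (![r / c₂, 0] : Fin 2 → ℝ) 0 * (⟪gradient (F i) x, v⟫ / αb i)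
        + (![r / c₂, 0] : Fin 2 → ℝ) 1 * (⟪gradient (F i) x, s⟫ / αb i))
        ≤ -(r ^ 2 * ‖v‖ ^ 2 / c₂) := by
      apply Finset.sup'_le
      intro i _
      have := mul_le_mul_of_nonneg_left (hi i) ht.le
      have h2 : r / c₂ * -(r * ‖v‖ ^ 2) = -(r ^ 2 * ‖v‖ ^ 2 / c₂) := by ring
      simpa [← h2] using this
    have h2 : (![r / c₂, 0] : Fin 2 → ℝ) ⬝ᵥ (H *ᵥ ![r / c₂, 0]) = (r / c₂) ^ 2 * H 0 0 := by
      simp [Matrix.mulVec, dotProduct, Fin.sum_univ_two]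
      ring
    have h3 := mul_le_mul_of_nonneg_left hH00 (sq_nonneg (r / c₂))
    have h4 : (r / c₂) ^ 2 * (c₂ * ‖v‖ ^ 2) = r ^ 2 * ‖v‖ ^ 2 / c₂ := by field_simp
    rw [h2]
    linarith
  have heq := le_antisymm hinf hinf'
  rw [hD, heq]
  have hφp : subModel F αb x v s H p = (Finset.univ.sup' Finset.univ_nonempty fun i =>
      p 0 * (⟪gradient (F i) x, v⟫ / αb i) + p 1 * (⟪gradient (F i) x, s⟫ / αb i))
      + 1 / 2 * (p ⬝ᵥ (H *ᵥ p)) := rfl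
  linarith
end

section
/- Under the stated subspace-minimization setup, the direction d = μ* v + ν* s satisfies the two-sided norm bound (min_{i}(α_i/ᾱ_i)² / (c₂ · max_{i}(α_i/ᾱ_i))) · ‖v‖ ≤ ‖d‖ ≤ (2 · max_{i}(α_i/ᾱ_i) / c₁) · ‖v‖, where the min and max are over i ∈ {1,…,m}. -/
open RealInnerProductSpace Matrix

lemma aux_small {A B : ℝ} (h : ∀ t, 0 < t → t ≤ 1 → A ≤ t * B) : A ≤ 0 := by
  by_contra hA
  push Not at hA
  have hpos : 0 < A + |B| := by positivity
  have h1 := h (A / (A + |B|)) (by positivity)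
    (by rw [div_le_one hpos]; linarith [abs_nonneg B])
  rw [div_mul_eq_mul_div, le_div_iff₀ hpos] at h1
  nlinarith [le_abs_self B, mul_pos hA hA]

lemma aux_scale {a b : ℝ} (h : ∀ t, 0 ≤ t → a + 1 / 2 * b ≤ t * a + 1 / 2 * (t ^ 2 * b)) :
    a = -b := by
  have h1 : a + b ≤ 0 := aux_small (B := b / 2) fun t ht ht1 => by
    have := h (1 - t) (by linarith)
    have h2 : 0 ≤ t * (t * (b / 2) - (a + b)) := by nlinarith
    have := nonneg_of_mul_nonneg_right h2 ht
    linarith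
  have h2 : -(a + b) ≤ 0 := aux_small (B := b / 2) fun t ht ht1 => by
    have := h (1 + t) (by linarith)
    have h2 : 0 ≤ t * (t * (b / 2) + (a + b)) := by nlinarith
    have := nonneg_of_mul_nonneg_right h2 ht
    linarith
  linarith

lemma aux_sup_scale {m : ℕ} [NeZero m] (f g : Fin m → ℝ) (t : ℝ) (ht : 0 ≤ t)
    (hfg : ∀ i, g i = t * f i) :
    Finset.univ.sup' Finset.univ_nonempty g ≤ t * Finset.univ.sup' Finset.univ_nonempty f := by
  refine Finset.sup'_le _ _ fun i hi => ?_
  rw [hfg]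
  exact mul_le_mul_of_nonneg_left (Finset.le_sup' f hi) ht

/-- two-sided norm bound for the subspace-minimization direction. -/
theorem norm_bounds_of_subspace_minimizer {n m : ℕ} [NeZero m]
    (F : Fin m → EuclideanSpace ℝ (Fin n) → ℝ)
    (hF : ∀ i, ContDiff ℝ 1 (F i))
    (x : EuclideanSpace ℝ (Fin n))
    (α αb : Fin m → ℝ) (hα : ∀ i, 0 < α i) (hαb : ∀ i, 0 < αb i)
    (v : EuclideanSpace ℝ (Fin n))
    (hv : ∀ w, bbObj F α x v ≤ bbObj F α x w) (hv0 : v ≠ 0)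
    (s : EuclideanSpace ℝ (Fin n)) (hs0 : s ≠ 0)
    (H : Matrix (Fin 2) (Fin 2) ℝ) (hH : H.IsSymm)
    (c₁ c₂ : ℝ) (hc₁ : 0 < c₁) (hc₁₂ : c₁ ≤ c₂)
    (hspec : ∀ z : Fin 2 → ℝ,
      c₁ * (z ⬝ᵥ z) ≤
          z ⬝ᵥ ((Matrix.diagonal ![‖v‖⁻¹, ‖s‖⁻¹] * H * Matrix.diagonal ![‖v‖⁻¹, ‖s‖⁻¹]) *ᵥ z) ∧
        z ⬝ᵥ ((Matrix.diagonal ![‖v‖⁻¹, ‖s‖⁻¹] * H * Matrix.diagonal ![‖v‖⁻¹, ‖s‖⁻¹]) *ᵥ z) ≤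
          c₂ * (z ⬝ᵥ z))
    (p : Fin 2 → ℝ)
    (hp : ∀ q : Fin 2 → ℝ, subModel F αb x v s H p ≤ subModel F αb x v s H q)
    (d : EuclideanSpace ℝ (Fin n)) (hd : d = p 0 • v + p 1 • s) :
    (Finset.univ.inf' Finset.univ_nonempty fun i => (α i / αb i) ^ 2) / (c₂ * Finset.univ.sup' Finset.univ_nonempty fun i => α i / αb i) * ‖v‖ ≤ ‖d‖ ∧ ‖d‖ ≤ 2 * (Finset.univ.sup' Finset.univ_nonempty fun i => α i / αb i) / c₁ * ‖v‖ := by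
  have hvn : 0 < ‖v‖ := norm_pos_iff.mpr hv0
  have hsn : 0 < ‖s‖ := norm_pos_iff.mpr hs0
  have hc₂ : 0 < c₂ := lt_of_lt_of_le hc₁ hc₁₂
  -- optimality of `v`
  have hgv : ∀ i, ⟪gradient (F i) x, v⟫ / α i ≤ -‖v‖ ^ 2 := by
    have h1 : (Finset.univ.sup' Finset.univ_nonempty fun i => ⟪gradient (F i) x, v⟫ / α i)
        = -‖v‖ ^ 2 := by
      apply aux_scale
      intro t ht
      have h2 := hv (t • v)
      unfold bbObj at h2
      have h3 := aux_sup_scale (fun i => ⟪gradient (F i) x, v⟫ / α i)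
        (fun i => ⟪gradient (F i) x, t • v⟫ / α i) t ht
        (fun i => by simp only [inner_smul_right]; ring)
      rw [norm_smul, mul_pow, Real.norm_eq_abs, sq_abs] at h2
      linarith
    intro i
    rw [← h1]
    exact Finset.le_sup' (fun i => ⟪gradient (F i) x, v⟫ / α i) (Finset.mem_univ i)
  have hgw : ∀ w, ∃ i, -⟪v, w⟫ ≤ ⟪gradient (F i) x, w⟫ / α i := by
    intro w
    obtain ⟨j, -, hj⟩ := Finset.exists_mem_eq_sup' Finset.univ_nonempty
      (fun i => ⟪gradient (F i) x, w⟫ / α i)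
    refine ⟨j, ?_⟩
    have key : -⟪v, w⟫ - ⟪gradient (F j) x, w⟫ / α j ≤ 0 :=
      aux_small (B := ‖w‖ ^ 2 / 2) fun t ht ht1 => by
      have h2 := hv (v + t • w)
      unfold bbObj at h2
      have h3 : (Finset.univ.sup' Finset.univ_nonempty
            fun i => ⟪gradient (F i) x, v + t • w⟫ / α i) ≤
          (Finset.univ.sup' Finset.univ_nonempty fun i => ⟪gradient (F i) x, v⟫ / α i)
            + t * (⟪gradient (F j) x, w⟫ / α j) := by
        refine Finset.sup'_le _ _ fun i hi => ?_
        have e1 := Finset.le_sup' (fun i => ⟪gradient (F i) x, v⟫ / α i) hi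
        have e2 := Finset.le_sup' (fun i => ⟪gradient (F i) x, w⟫ / α i) hi
        rw [hj] at e2
        have e3 := mul_le_mul_of_nonneg_left e2 ht.le
        have e4 : ⟪gradient (F i) x, v + t • w⟫ / α i = ⟪gradient (F i) x, v⟫ / α i
            + t * (⟪gradient (F i) x, w⟫ / α i) := by
          rw [inner_add_right, inner_smul_right]; ring
        linarith
      rw [norm_add_sq_real, norm_smul, mul_pow, Real.norm_eq_abs, sq_abs,
        inner_smul_right] at h2
      have h4 : 0 ≤ t * (t * (‖w‖ ^ 2 / 2) - (-⟪v, w⟫ - ⟪gradient (F j) x, w⟫ / α j)) := by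
        nlinarith
      have := nonneg_of_mul_nonneg_right h4 ht
      linarith
    linarith
  set M := Finset.univ.sup' Finset.univ_nonempty fun i => α i / αb i with hM
  have hMi : ∀ i, α i / αb i ≤ M := fun i =>
    Finset.le_sup' (fun i => α i / αb i) (Finset.mem_univ i)
  have hMpos : 0 < M := lt_of_lt_of_le (div_pos (hα 0) (hαb 0)) (hMi 0)
  obtain ⟨k, -, hk⟩ := Finset.exists_mem_eq_inf' Finset.univ_nonempty
      (fun i => (α i / αb i) ^ 2)
  have hki : ∀ i, α k / αb k ≤ α i / αb i := by
    intro i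
    have h1 := Finset.inf'_le (fun i => (α i / αb i) ^ 2) (Finset.mem_univ i)
    rw [hk] at h1
    exact le_of_sq_le_sq h1 (div_pos (hα i) (hαb i)).le
  rw [hk]
  have hκ : 0 < α k / αb k := div_pos (hα k) (hαb k)
  set κ := α k / αb k with hκdef
  -- quadratic form
  have hQ : ∀ q : Fin 2 → ℝ, c₁ * (q 0 ^ 2 * ‖v‖ ^ 2 + q 1 ^ 2 * ‖s‖ ^ 2) ≤ q ⬝ᵥ (H *ᵥ q) ∧
      q ⬝ᵥ (H *ᵥ q) ≤ c₂ * (q 0 ^ 2 * ‖v‖ ^ 2 + q 1 ^ 2 * ‖s‖ ^ 2) := by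
    intro q
    have h1 := hspec ![‖v‖ * q 0, ‖s‖ * q 1]
    have e1 : (![‖v‖ * q 0, ‖s‖ * q 1] : Fin 2 → ℝ) ⬝ᵥ ![‖v‖ * q 0, ‖s‖ * q 1]
        = q 0 ^ 2 * ‖v‖ ^ 2 + q 1 ^ 2 * ‖s‖ ^ 2 := by
      simp [dotProduct, Fin.sum_univ_two]; ring
    have e2 : (![‖v‖ * q 0, ‖s‖ * q 1] : Fin 2 → ℝ) ⬝ᵥ
        ((Matrix.diagonal ![‖v‖⁻¹, ‖s‖⁻¹] * H * Matrix.diagonal ![‖v‖⁻¹, ‖s‖⁻¹]) *ᵥ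
          ![‖v‖ * q 0, ‖s‖ * q 1]) = q ⬝ᵥ (H *ᵥ q) := by
      simp [dotProduct, Matrix.mulVec, Fin.sum_univ_two]
      field_simp
    rwa [e1, e2] at h1
  set hd' := Finset.univ.sup' Finset.univ_nonempty fun i =>
      p 0 * (⟪gradient (F i) x, v⟫ / αb i) + p 1 * (⟪gradient (F i) x, s⟫ / αb i) with hhd
  have hopt : hd' = -(p ⬝ᵥ (H *ᵥ p)) := by
    apply aux_scale
    intro t ht
    have h2 := hp (t • p)
    unfold subModel at h2
    have h3 := aux_sup_scale (fun i =>
      p 0 * (⟪gradient (F i) x, v⟫ / αb i) + p 1 * (⟪gradient (F i) x, s⟫ / αb i))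
      (fun i => (t • p) 0 * (⟪gradient (F i) x, v⟫ / αb i)
        + (t • p) 1 * (⟪gradient (F i) x, s⟫ / αb i)) t ht
      (fun i => by simp only [Pi.smul_apply, smul_eq_mul]; ring)
    have e : (t • p) ⬝ᵥ (H *ᵥ (t • p)) = t ^ 2 * (p ⬝ᵥ (H *ᵥ p)) := by
      rw [Matrix.mulVec_smul, dotProduct_smul, smul_dotProduct, smul_eq_mul, smul_eq_mul]; ring
    rw [e] at h2
    linarith
  have hlow : -(M * ‖v‖ * ‖d‖) ≤ hd' := by
    obtain ⟨i, hi⟩ := hgw d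
    have h1 := Finset.le_sup' (fun i =>
      p 0 * (⟪gradient (F i) x, v⟫ / αb i) + p 1 * (⟪gradient (F i) x, s⟫ / αb i))
      (Finset.mem_univ i)
    refine le_trans ?_ h1
    have e : p 0 * (⟪gradient (F i) x, v⟫ / αb i) + p 1 * (⟪gradient (F i) x, s⟫ / αb i)
        = (α i / αb i) * (⟪gradient (F i) x, d⟫ / α i) := by
      have := (hα i).ne'
      have := (hαb i).ne'
      rw [hd, inner_add_right, inner_smul_right, inner_smul_right]
      field_simp
    simp only [e]
    have h2 : -(‖v‖ * ‖d‖) ≤ ⟪gradient (F i) x, d⟫ / α i := by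
      linarith [real_inner_le_norm v d]
    have hr := div_pos (hα i) (hαb i)
    have h3 := mul_le_mul_of_nonneg_left h2 hr.le
    have h4 := mul_le_mul_of_nonneg_right (hMi i) (by positivity : 0 ≤ ‖v‖ * ‖d‖)
    linarith
  constructor
  · have h1 := hp ![κ / c₂, 0]
    unfold subModel at h1
    rw [← hhd] at h1
    have h2 : (Finset.univ.sup' Finset.univ_nonempty fun i =>
        (![κ / c₂, 0] : Fin 2 → ℝ) 0 * (⟪gradient (F i) x, v⟫ / αb i)
          + (![κ / c₂, 0] : Fin 2 → ℝ) 1 * (⟪gradient (F i) x, s⟫ / αb i))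
        ≤ κ / c₂ * (-(κ * ‖v‖ ^ 2)) := by
      refine Finset.sup'_le _ _ fun i hi => ?_
      have e : ⟪gradient (F i) x, v⟫ / αb i
        = (α i / αb i) * (⟪gradient (F i) x, v⟫ / α i) := by
        have := (hα i).ne'
        have := (hαb i).ne'
        field_simp
      simp only [Matrix.cons_val_zero, Matrix.cons_val_one, zero_mul, add_zero]
      apply mul_le_mul_of_nonneg_left _ (by positivity)
      rw [e]
      have hr := div_pos (hα i) (hαb i)
      have h3 := mul_le_mul_of_nonneg_left (hgv i) hr.le
      have h4 := mul_le_mul_of_nonneg_right (hki i) (by positivity : 0 ≤ ‖v‖ ^ 2)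
      linarith
    have h3 := (hQ ![κ / c₂, 0]).2
    simp only [Matrix.cons_val_zero, Matrix.cons_val_one] at h3
    have e3 : c₂ * ((κ / c₂) ^ 2 * ‖v‖ ^ 2 + 0 ^ 2 * ‖s‖ ^ 2) = κ ^ 2 * ‖v‖ ^ 2 / c₂ := by
      field_simp; ring
    have e4 : κ / c₂ * (-(κ * ‖v‖ ^ 2)) = -(κ ^ 2 * ‖v‖ ^ 2 / c₂) := by
      field_simp
    rw [e3] at h3
    rw [e4] at h2
    have h5 : κ ^ 2 * ‖v‖ ^ 2 / c₂ ≤ M * ‖v‖ * ‖d‖ := by linarith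
    rw [div_le_iff₀ hc₂] at h5
    rw [div_mul_eq_mul_div, div_le_iff₀ (by positivity)]
    have h6 : ‖v‖ * (κ ^ 2 * ‖v‖) ≤ ‖v‖ * (‖d‖ * (c₂ * M)) := by linarith
    exact le_of_mul_le_mul_left h6 hvn
  · have h1 := (hQ p).1
    have h2 : ‖d‖ ≤ |p 0| * ‖v‖ + |p 1| * ‖s‖ := by
      rw [hd]
      refine (norm_add_le _ _).trans ?_
      rw [norm_smul, norm_smul, Real.norm_eq_abs, Real.norm_eq_abs]
    have h3 : ‖d‖ ^ 2 ≤ 2 * (p 0 ^ 2 * ‖v‖ ^ 2 + p 1 ^ 2 * ‖s‖ ^ 2) := by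
      have e1 := pow_le_pow_left₀ (norm_nonneg d) h2 2
      have e2 := sq_nonneg (|p 0| * ‖v‖ - |p 1| * ‖s‖)
      rw [← sq_abs (p 0), ← sq_abs (p 1)]
      linarith
    have h4 : c₁ * ‖d‖ ^ 2 ≤ 2 * (M * ‖v‖ * ‖d‖) := by
      have := mul_le_mul_of_nonneg_left h3 hc₁.le
      linarith
    rw [div_mul_eq_mul_div, le_div_iff₀ hc₁]
    rcases (norm_nonneg d).eq_or_lt with h0 | h0
    · rw [← h0, zero_mul]; positivity
    · have h6 : ‖d‖ * (‖d‖ * c₁) ≤ ‖d‖ * (2 * M * ‖v‖) := by linarith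
      exact le_of_mul_le_mul_left h6 h0
end

section
/- Let g_1,…,g_m ∈ ℝ^n, let α ∈ ℝ^m have positive entries, and let v be the unique minimizer over ℝ^n of ψ(w) = max_{i∈{1,…,m}} ⟨g_i, w⟩/α_i + ½‖w‖². Then ⟨g_i, v⟩ ≤ −α_i ‖v‖² for every i ∈ {1,…,m}. -/
open RealInnerProductSpace

/-- `ψ(w) = max_i ⟪g_i, w⟫/α_i + ½‖w‖²`. -/
noncomputable def bbObjG {n m : ℕ} [NeZero m] (g : Fin m → EuclideanSpace ℝ (Fin n))
    (α : Fin m → ℝ) (w : EuclideanSpace ℝ (Fin n)) : ℝ :=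
  (Finset.univ.sup' Finset.univ_nonempty fun i => ⟪g i, w⟫ / α i) + (1 / 2) * ‖w‖ ^ 2

/-- if `v` minimizes `ψ(w) = max_i ⟪g_i, w⟫/α_i + ½‖w‖²`, then
`⟪g_i, v⟫ ≤ −α_i ‖v‖²` for every `i`. -/
theorem inner_le_of_bb_minimizer {n m : ℕ} [NeZero m]
    (g : Fin m → EuclideanSpace ℝ (Fin n)) (α : Fin m → ℝ) (hα : ∀ i, 0 < α i)
    (v : EuclideanSpace ℝ (Fin n)) (hv : ∀ w, bbObjG g α v ≤ bbObjG g α w) :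
    ∀ i, ⟪g i, v⟫ ≤ -(α i * ‖v‖ ^ 2) := by
  intro i
  have hle : ∀ j, ⟪g j, v⟫ / α j ≤
      Finset.univ.sup' Finset.univ_nonempty fun i => ⟪g i, v⟫ / α i := fun j =>
    Finset.le_sup' (fun i => ⟪g i, v⟫ / α i) (Finset.mem_univ j)
  have key : ∀ t : ℝ, 0 ≤ t →
      (Finset.univ.sup' Finset.univ_nonempty fun i => ⟪g i, v⟫ / α i) + (1 / 2) * ‖v‖ ^ 2 ≤
      t * (Finset.univ.sup' Finset.univ_nonempty fun i => ⟪g i, v⟫ / α i)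
        + (1 / 2) * (t ^ 2 * ‖v‖ ^ 2) := by
    intro t ht
    have h := hv (t • v)
    unfold bbObjG at h
    have h2 : (Finset.univ.sup' Finset.univ_nonempty fun i => ⟪g i, t • v⟫ / α i) ≤
        t * (Finset.univ.sup' Finset.univ_nonempty fun i => ⟪g i, v⟫ / α i) := by
      apply Finset.sup'_le
      intro j _
      rw [real_inner_smul_right, mul_div_assoc]
      exact mul_le_mul_of_nonneg_left (hle j) ht
    rw [norm_smul, mul_pow, Real.norm_eq_abs, sq_abs] at h
    linarith
  have hi := hle i
  generalize (Finset.univ.sup' Finset.univ_nonempty fun i => ⟪g i, v⟫ / α i) = M at *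
  have hN : 0 ≤ ‖v‖ ^ 2 := by positivity
  generalize ‖v‖ ^ 2 = N at *
  have hMN : M + N ≤ 0 := by
    by_contra hcon
    push Not at hcon
    have hd : 0 < M + N + N := by linarith
    have h := key (N / (M + N + N)) (by positivity)
    obtain ⟨s, hs⟩ : ∃ s, s = (M + N) / (M + N + N) := ⟨_, rfl⟩
    have hs0 : 0 < s := hs ▸ by positivity
    have ht : N / (M + N + N) = 1 - s := by rw [hs]; field_simp; ring
    have hsN : s * (M + N + N) = M + N := by rw [hs]; field_simp
    rw [ht] at h
    have h3 : s * (M + N - s * N / 2) ≤ 0 := by nlinarith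
    have h4 : 0 < M + N - s * N / 2 := by nlinarith [mul_pos hs0 hcon, mul_nonneg hs0.le hN]
    nlinarith [mul_pos hs0 h4]
  rw [div_le_iff₀ (hα i)] at hi
  nlinarith [hα i]
end

section
/- Let x ∈ ℝ^n, let α ∈ ℝ^m have positive entries, and let v(x;α) be the Barzilai–Borwein descent direction at x. Then v(x;α) = 0 if and only if x is a Pareto critical point of F. -/
open RealInnerProductSpace

/-- the Barzilai–Borwein descent direction `v(x;α)` vanishes if and only if
`x` is a Pareto critical point of `F`. -/
theorem bb_direction_eq_zero_iff_pareto_critical {n m : ℕ} [NeZero m]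
    (F : Fin m → EuclideanSpace ℝ (Fin n) → ℝ)
    (hF : ∀ i, ContDiff ℝ 1 (F i))
    (x : EuclideanSpace ℝ (Fin n))
    (α : Fin m → ℝ) (hα : ∀ i, 0 < α i)
    (v : EuclideanSpace ℝ (Fin n)) (hv : ∀ w, bbObj F α x v ≤ bbObj F α x w) :
    v = 0 ↔ ¬ ∃ d : EuclideanSpace ℝ (Fin n), ∀ i, ⟪gradient (F i) x, d⟫ < 0 := by
  have h0 : bbObj F α x 0 = 0 := by
    simp [bbObj]
  constructor
  · rintro rfl ⟨d, hd⟩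
    set M : ℝ := Finset.univ.sup' Finset.univ_nonempty
      fun i => ⟪gradient (F i) x, d⟫ / α i with hM
    have hMneg : M < 0 := by
      rw [hM, Finset.sup'_lt_iff]
      intro i _
      exact div_neg_of_neg_of_pos (hd i) (hα i)
    have hN : 0 ≤ ‖d‖ ^ 2 := by positivity
    have key : ∀ t : ℝ, 0 < t → 0 ≤ t * M + (1 / 2) * (t ^ 2 * ‖d‖ ^ 2) := by
      intro t ht
      have h1 := hv (t • d)
      rw [h0] at h1
      unfold bbObj at h1
      rw [norm_smul, mul_pow, Real.norm_eq_abs, sq_abs] at h1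
      refine h1.trans (add_le_add ?_ le_rfl)
      apply Finset.sup'_le
      intro i hi
      rw [real_inner_smul_right, mul_div_assoc]
      exact mul_le_mul_of_nonneg_left
        (Finset.le_sup' (fun i => ⟪gradient (F i) x, d⟫ / α i) hi) ht.le
    have hpos : 0 < ‖d‖ ^ 2 + 1 := by linarith
    have ht : 0 < -M / (‖d‖ ^ 2 + 1) := div_pos (by linarith) hpos
    have h2 := key _ ht
    set t := -M / (‖d‖ ^ 2 + 1) with htdef
    have h3 : t * (‖d‖ ^ 2 + 1) = -M := by
      rw [htdef]; field_simp
    have hMe : M = -(t * (‖d‖ ^ 2 + 1)) := by linarith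
    rw [hMe] at h2
    nlinarith [mul_pos ht ht, mul_nonneg (mul_pos ht ht).le hN]
  · intro h
    by_contra hne
    apply h
    refine ⟨v, fun i => ?_⟩
    have h1 := hv 0
    rw [h0] at h1
    unfold bbObj at h1
    have h2 := Finset.le_sup' (fun i => ⟪gradient (F i) x, v⟫ / α i) (Finset.mem_univ i)
    have h3 : 0 < ‖v‖ ^ 2 := by
      have := norm_pos_iff.mpr hne
      positivity
    have h4 : ⟪gradient (F i) x, v⟫ / α i < 0 := by
      linarith
    by_contra hc
    exact absurd (div_nonneg (not_lt.mp hc) (hα i).le) (not_le.mpr h4)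
end

section
/- Let x ∈ ℝ^n, let α, ᾱ ∈ ℝ^m have positive entries, let v = v(x;α) be the Barzilai–Borwein descent direction at x, and let d ∈ ℝ^n satisfy max_{i∈{1,…,m}} ⟨∇F_i(x), d⟩/α_i ≤ 0. Then D_ᾱ(x,d) ≥ −max_{i∈{1,…,m}}(α_i/ᾱ_i) · ‖v‖ · ‖d‖. -/
open RealInnerProductSpace

theorem Dval_smul_pos {n m : ℕ} [NeZero m] (F : Fin m → EuclideanSpace ℝ (Fin n) → ℝ)
    (α : Fin m → ℝ) (x d : EuclideanSpace ℝ (Fin n)) (t : ℝ) (ht : 0 ≤ t) :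
    Dval F α x (t • d) ≤ t * Dval F α x d := by
  unfold Dval
  apply Finset.sup'_le
  intro i hi
  rw [inner_smul_right, mul_div_assoc]
  exact mul_le_mul_of_nonneg_left
    (Finset.le_sup' (fun i => ⟪gradient (F i) x, d⟫ / α i) hi) ht

theorem bbObj_smul {n m : ℕ} [NeZero m] (F : Fin m → EuclideanSpace ℝ (Fin n) → ℝ)
    (α : Fin m → ℝ) (x d : EuclideanSpace ℝ (Fin n)) (t : ℝ) (ht : 0 ≤ t) :
    bbObj F α x (t • d) ≤ t * Dval F α x d + (1 / 2) * (t ^ 2 * ‖d‖ ^ 2) := by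
  have h := Dval_smul_pos F α x d t ht
  have e : bbObj F α x (t • d) = Dval F α x (t • d) + (1 / 2) * ‖t • d‖ ^ 2 := rfl
  rw [e, norm_smul, mul_pow, Real.norm_eq_abs, sq_abs]
  linarith

/-- if `v = v(x;α)` is the Barzilai–Borwein descent direction and
`max_i ⟪∇F_i(x), d⟫/α_i ≤ 0`, then `D_ᾱ(x,d) ≥ −max_i(α_i/ᾱ_i)·‖v‖·‖d‖`. -/
theorem Dval_lower_bound_of_descent {n m : ℕ} [NeZero m]
    (F : Fin m → EuclideanSpace ℝ (Fin n) → ℝ)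
    (hF : ∀ i, ContDiff ℝ 1 (F i))
    (x : EuclideanSpace ℝ (Fin n))
    (α αb : Fin m → ℝ) (hα : ∀ i, 0 < α i) (hαb : ∀ i, 0 < αb i)
    (v : EuclideanSpace ℝ (Fin n)) (hv : ∀ w, bbObj F α x v ≤ bbObj F α x w)
    (d : EuclideanSpace ℝ (Fin n)) (hd : Dval F α x d ≤ 0) :
    -((Finset.univ.sup' Finset.univ_nonempty fun i => α i / αb i) * ‖v‖ * ‖d‖)
      ≤ Dval F αb x d := by
  have e : bbObj F α x v = Dval F α x v + (1 / 2) * ‖v‖ ^ 2 := rfl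
  -- `-‖v‖² ≤ D_α(x, v)`
  have h1 : -‖v‖ ^ 2 ≤ Dval F α x v := by
    by_contra! hlt
    have hp : 0 < ‖v‖ ^ 2 + 1 := by positivity
    obtain ⟨ε, hε⟩ : ∃ ε, ε = -(Dval F α x v + ‖v‖ ^ 2) / (‖v‖ ^ 2 + 1) := ⟨_, rfl⟩
    have hε0 : 0 < ε := by
      rw [hε]; apply div_pos _ hp; linarith
    have hmul : ε * (‖v‖ ^ 2 + 1) = -(Dval F α x v + ‖v‖ ^ 2) := by
      rw [hε]; field_simp
    have h := (hv _).trans (bbObj_smul F α x v (1 + ε) (by linarith))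
    rw [e] at h
    have h2 : 0 ≤ ε * (Dval F α x v + ‖v‖ ^ 2 + 1 / 2 * (ε * ‖v‖ ^ 2)) := by linarith
    have h3 := nonneg_of_mul_nonneg_right h2 hε0
    have h4 : 0 ≤ ε * ‖v‖ ^ 2 := by positivity
    linarith
  -- `-‖v‖‖d‖ ≤ D_α(x, d)`
  have h2 : -(‖v‖ * ‖d‖) ≤ Dval F α x d := by
    by_cases hd0 : d = 0
    · subst hd0
      simp [Dval]
    have hdp : 0 < ‖d‖ := norm_pos_iff.mpr hd0
    have h := (hv _).trans (bbObj_smul F α x d (-Dval F α x d / ‖d‖ ^ 2)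
      (div_nonneg (by linarith) (by positivity)))
    rw [e] at h
    have h3 : -Dval F α x d / ‖d‖ ^ 2 * Dval F α x d
        + 1 / 2 * ((-Dval F α x d / ‖d‖ ^ 2) ^ 2 * ‖d‖ ^ 2)
        = -(1 / 2) * (Dval F α x d ^ 2 / ‖d‖ ^ 2) := by
      field_simp; ring
    rw [h3] at h
    have h4 : Dval F α x d ^ 2 / ‖d‖ ^ 2 ≤ ‖v‖ ^ 2 := by linarith
    rw [div_le_iff₀ (by positivity), ← mul_pow] at h4
    exact (abs_le.mp (abs_le_of_sq_le_sq h4 (by positivity))).1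
  obtain ⟨i, hi, hmax⟩ := Finset.exists_mem_eq_sup' (s := (Finset.univ : Finset (Fin m)))
    Finset.univ_nonempty (fun i => ⟪gradient (F i) x, d⟫ / α i)
  have h3 : -(‖v‖ * ‖d‖) ≤ ⟪gradient (F i) x, d⟫ / α i := by
    rw [← hmax]; exact h2
  have h4 : ⟪gradient (F i) x, d⟫ / αb i ≤ Dval F αb x d :=
    Finset.le_sup' (fun i => ⟪gradient (F i) x, d⟫ / αb i) hi
  have h5 := Finset.le_sup' (fun i => α i / αb i) hi
  have h6 : ⟪gradient (F i) x, d⟫ / αb i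
      = (α i / αb i) * (⟪gradient (F i) x, d⟫ / α i) := by
    have := (hα i).ne'
    have := (hαb i).ne'
    field_simp
  have h7 := mul_le_mul_of_nonneg_left h3 (div_pos (hα i) (hαb i)).le
  have h8 := mul_le_mul_of_nonneg_right h5 (by positivity : 0 ≤ ‖v‖ * ‖d‖)
  rw [mul_assoc]
  linarith
end

section
/- Let x⁰ ∈ ℝ^n be such that the level set L = {x ∈ ℝ^n : F_i(x) ≤ F_i(x⁰) for all i} is compact. Let x^{k+1} = x^k + t_k d_k with t_k > 0 and d_k ∈ ℝ^n, and suppose there exist constants σ₁ > 0, α_min > 0, c₁ > 0 and vectors ᾱ^k ∈ ℝ^m with ᾱ^k_i ≥ α_min such that for all k and all i: (F_i(x^{k+1}) − F_i(x^k))/ᾱ^k_i ≤ σ₁ t_k D_{ᾱ^k}(x^k, d_k) and D_{ᾱ^k}(x^k, d_k) ≤ −(c₁/2)‖d_k‖². Then each sequence {F_i(x^k)} is monotone nonincreasing, {x^k} ⊂ L, and Σ_{k=0}^∞ t_k ‖d_k‖² < ∞. -/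
open RealInnerProductSpace

/-- under the Armijo-type decrease and the sufficient descent condition, each
`{F_i(x^k)}` is monotone nonincreasing, the iterates stay in the level set, and
`Σ_k t_k ‖d_k‖² < ∞`. -/
theorem iterates_in_level_set_and_summable {n m : ℕ} [NeZero m]
    (F : Fin m → EuclideanSpace ℝ (Fin n) → ℝ)
    (hF : ∀ i, ContDiff ℝ 1 (F i))
    (x d : ℕ → EuclideanSpace ℝ (Fin n)) (t : ℕ → ℝ) (ht : ∀ k, 0 < t k)
    (hlevel : IsCompact {y : EuclideanSpace ℝ (Fin n) | ∀ i, F i y ≤ F i (x 0)})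
    (σ₁ αmin c₁ : ℝ) (hσ₁ : 0 < σ₁) (hαmin : 0 < αmin) (hc₁ : 0 < c₁)
    (αb : ℕ → Fin m → ℝ) (hαb : ∀ k i, αmin ≤ αb k i)
    (hupdate : ∀ k, x (k + 1) = x k + t k • d k)
    (harmijo : ∀ k i,
      (F i (x (k + 1)) - F i (x k)) / αb k i ≤ σ₁ * t k * Dval F (αb k) (x k) (d k))
    (hdesc : ∀ k, Dval F (αb k) (x k) (d k) ≤ -(c₁ / 2) * ‖d k‖ ^ 2) :
    (∀ i, Antitone fun k => F i (x k)) ∧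
    (∀ k, x k ∈ {y : EuclideanSpace ℝ (Fin n) | ∀ i, F i y ≤ F i (x 0)}) ∧
    Summable (fun k => t k * ‖d k‖ ^ 2) := by
  have hC : 0 < σ₁ * (c₁ / 2) * αmin := by positivity
  have key : ∀ k i, σ₁ * (c₁ / 2) * αmin * (t k * ‖d k‖ ^ 2) ≤ F i (x k) - F i (x (k + 1)) := by
    intro k i
    have hα : 0 < αb k i := lt_of_lt_of_le hαmin (hαb k i)
    have h1 : σ₁ * t k * Dval F (αb k) (x k) (d k) ≤ σ₁ * t k * (-(c₁ / 2) * ‖d k‖ ^ 2) :=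
      mul_le_mul_of_nonneg_left (hdesc k) (mul_pos hσ₁ (ht k)).le
    have h2 := (div_le_iff₀ hα).1 ((harmijo k i).trans h1)
    have h3 : 0 ≤ σ₁ * t k * ((c₁ / 2) * ‖d k‖ ^ 2) := by
      have := ht k
      positivity
    have h4 := mul_le_mul_of_nonneg_left (hαb k i) h3
    linarith
  have hnn : ∀ k, 0 ≤ t k * ‖d k‖ ^ 2 := fun k => mul_nonneg (ht k).le (sq_nonneg _)
  have hanti : ∀ i, Antitone fun k => F i (x k) := by
    intro i
    refine antitone_nat_of_succ_le fun k => ?_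
    have := key k i
    have := mul_nonneg hC.le (hnn k)
    linarith
  have hmem : ∀ k, x k ∈ {y : EuclideanSpace ℝ (Fin n) | ∀ i, F i y ≤ F i (x 0)} :=
    fun k i => hanti i (Nat.zero_le k)
  refine ⟨hanti, hmem, ?_⟩
  obtain ⟨B, hB⟩ := hlevel.bddBelow_image (hF 0).continuous.continuousOn
  refine summable_of_sum_range_le (c := (F 0 (x 0) - B) / (σ₁ * (c₁ / 2) * αmin)) hnn fun N => ?_
  rw [le_div_iff₀ hC, mul_comm, Finset.mul_sum]
  have h5 : B ≤ F 0 (x N) := hB ⟨x N, hmem N, rfl⟩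
  calc _ ≤ ∑ k ∈ Finset.range N, (F 0 (x k) - F 0 (x (k + 1))) :=
        Finset.sum_le_sum fun k _ => key k 0
    _ = F 0 (x 0) - F 0 (x N) := Finset.sum_range_sub' (fun k => F 0 (x k)) N
    _ ≤ _ := by linarith
end

section
/- Global convergence: Let x⁰ ∈ ℝ^n be such that the level set L = {x ∈ ℝ^n : F_i(x) ≤ F_i(x⁰) for all i} is compact. Suppose constants 0 < α_min ≤ α_max, 0 < σ₁ ≤ σ₂ < 1, 0 < c₁ ≤ c₂ are given, and sequences x^k ∈ ℝ^n, d_k ∈ ℝ^n, t_k > 0, and α^k, ᾱ^k ∈ [α_min, α_max]^m satisfy for every k: v_k := v(x^k; α^k) ≠ 0; x^{k+1} = x^k + t_k d_k; the Wolfe conditions (F_i(x^{k+1}) − F_i(x^k))/ᾱ^k_i ≤ σ₁ t_k D_{ᾱ^k}(x^k, d_k) for all i and D_{ᾱ^k}(x^{k+1}, d_k) ≥ σ₂ D_{ᾱ^k}(x^k, d_k); the sufficient descent condition D_{ᾱ^k}(x^k, d_k) ≤ −(c₁/2)‖d_k‖²; and the bound D_{ᾱ^k}(x^k, d_k) ≤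 −min_{i}(α^k_i/ᾱ^k_i)² ‖v_k‖²/c₂. Then {x^k} has at least one accumulation point, and every accumulation point x* ∈ L is a Pareto critical point of F. -/
open RealInnerProductSpace Filter Topology

theorem Dval_ge {n m : ℕ} [NeZero m] (F : Fin m → EuclideanSpace ℝ (Fin n) → ℝ)
    (α : Fin m → ℝ) (x d : EuclideanSpace ℝ (Fin n)) (G a : ℝ) (ha : 0 < a)
    (hα : ∀ i, a ≤ α i) (hG : ∀ i, ‖gradient (F i) x‖ ≤ G) :
    -(G * ‖d‖ / a) ≤ Dval F α x d := by
  have h1 : ⟪gradient (F 0) x, d⟫ / α 0 ≤ Dval F α x d :=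
    Finset.le_sup' (fun i => ⟪gradient (F i) x, d⟫ / α i) (Finset.mem_univ 0)
  refine le_trans ?_ h1
  have h2 := abs_real_inner_le_norm (gradient (F 0) x) d
  have h3 : |⟪gradient (F 0) x, d⟫ / α 0| ≤ G * ‖d‖ / a := by
    rw [abs_div, abs_of_pos (ha.trans_le (hα 0))]
    apply div_le_div₀ _ _ ha (hα 0)
    · exact mul_nonneg ((norm_nonneg _).trans (hG 0)) (norm_nonneg _)
    · exact h2.trans (mul_le_mul_of_nonneg_right (hG 0) (norm_nonneg _))
  exact (abs_le.mp h3).1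

theorem Dval_diff {n m : ℕ} [NeZero m] (F : Fin m → EuclideanSpace ℝ (Fin n) → ℝ)
    (α : Fin m → ℝ) (x y d : EuclideanSpace ℝ (Fin n)) (e a : ℝ) (ha : 0 < a)
    (hα : ∀ i, a ≤ α i) (he : ∀ i, ‖gradient (F i) y - gradient (F i) x‖ ≤ e) :
    Dval F α y d ≤ Dval F α x d + e * ‖d‖ / a := by
  apply Finset.sup'_le
  intro i _
  have h1 : ⟪gradient (F i) x, d⟫ / α i ≤ Dval F α x d :=
    Finset.le_sup' (fun i => ⟪gradient (F i) x, d⟫ / α i) (Finset.mem_univ i)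
  have h2 := real_inner_le_norm (gradient (F i) y - gradient (F i) x) d
  have h3 : ⟪gradient (F i) y - gradient (F i) x, d⟫ / α i ≤ e * ‖d‖ / a := by
    apply div_le_div₀ _ _ ha (hα i)
    · exact mul_nonneg ((norm_nonneg _).trans (he i)) (norm_nonneg _)
    · exact h2.trans (mul_le_mul_of_nonneg_right (he i) (norm_nonneg _))
  rw [inner_sub_left, sub_div] at h3
  linarith

theorem continuous_grad {n : ℕ} (f : EuclideanSpace ℝ (Fin n) → ℝ) (hf : ContDiff ℝ 1 f) :
    Continuous (gradient f) := by
  unfold gradient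
  exact (LinearIsometryEquiv.continuous _).comp (hf.continuous_fderiv one_ne_zero)

theorem bb_lower {n m : ℕ} [NeZero m] (F : Fin m → EuclideanSpace ℝ (Fin n) → ℝ)
    (α : Fin m → ℝ) (x v dd : EuclideanSpace ℝ (Fin n)) (G a b η : ℝ) (ha : 0 < a)
    (hα : ∀ i, α i ∈ Set.Icc a b) (hG0 : 0 < G) (hG : ∀ i, ‖gradient (F i) x‖ ≤ G)
    (hv : ∀ w, bbObj F α x v ≤ bbObj F α x w) (hη : 0 < η)
    (hdd : ∀ i, ⟪gradient (F i) x, dd⟫ ≤ -η) :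
    η ^ 2 / (2 * b ^ 2 * (‖dd‖ ^ 2 + 1)) * a / G ≤ ‖v‖ := by
  have hb : 0 < b := ha.trans_le ((hα 0).1.trans (hα 0).2)
  set q := ‖dd‖ ^ 2 + 1 with hq
  have hq0 : 0 < q := by positivity
  set s := η / (b * q) with hs
  have hs0 : 0 < s := by positivity
  have h1 : Dval F α x (s • dd) ≤ -(s * η / b) := by
    apply Finset.sup'_le
    intro i _
    rw [real_inner_smul_right]
    have hp : 0 < α i := ha.trans_le (hα i).1
    have : s * η / b ≤ s * η / α i :=
      div_le_div_of_nonneg_left (by positivity) hp (hα i).2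
    have h4 : s * ⟪gradient (F i) x, dd⟫ / α i ≤ (s * (-η)) / α i := by
      gcongr
      exact hdd i
    have h5 : (s * (-η)) / α i = -(s * η / α i) := by ring
    linarith
  have h2 := Dval_ge F α x v G a ha (fun i => (hα i).1) hG
  have h3 : Dval F α x v + (1 / 2) * ‖v‖ ^ 2 ≤
    Dval F α x (s • dd) + (1 / 2) * ‖s • dd‖ ^ 2 := hv (s • dd)
  have h4 : ‖s • dd‖ ^ 2 ≤ s ^ 2 * q := by
    rw [norm_smul, mul_pow, Real.norm_eq_abs, sq_abs]
    have := sq_nonneg s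
    nlinarith
  have h5 : s * η / b - 1 / 2 * (s ^ 2 * q) = η ^ 2 / (2 * b ^ 2 * q) := by
    rw [hs]; field_simp; ring
  have h6 : η ^ 2 / (2 * b ^ 2 * q) ≤ G * ‖v‖ / a := by
    have := sq_nonneg ‖v‖
    linarith
  rw [le_div_iff₀ ha] at h6
  rw [div_le_iff₀ hG0]
  linarith

/-- global convergence: under compactness of the level set, the Wolfe
conditions, the sufficient descent condition and the Barzilai–Borwein descent bound, the
sequence `{x^k}` has at least one accumulation point, and every accumulation point in the
level set is a Pareto critical point. -/
theorem global_convergence_smbbmo {n m : ℕ} [NeZero m]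
    (F : Fin m → EuclideanSpace ℝ (Fin n) → ℝ)
    (hF : ∀ i, ContDiff ℝ 1 (F i))
    (x d v : ℕ → EuclideanSpace ℝ (Fin n)) (t : ℕ → ℝ) (ht : ∀ k, 0 < t k)
    (hlevel : IsCompact {y : EuclideanSpace ℝ (Fin n) | ∀ i, F i y ≤ F i (x 0)})
    (αmin αmax σ₁ σ₂ c₁ c₂ : ℝ)
    (hαminmax : 0 < αmin ∧ αmin ≤ αmax)
    (hσ : 0 < σ₁ ∧ σ₁ ≤ σ₂ ∧ σ₂ < 1)
    (hc : 0 < c₁ ∧ c₁ ≤ c₂)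
    (α αb : ℕ → Fin m → ℝ)
    (hα : ∀ k i, α k i ∈ Set.Icc αmin αmax) (hαb : ∀ k i, αb k i ∈ Set.Icc αmin αmax)
    (hv : ∀ k, ∀ w, bbObj F (α k) (x k) (v k) ≤ bbObj F (α k) (x k) w)
    (hv0 : ∀ k, v k ≠ 0)
    (hupdate : ∀ k, x (k + 1) = x k + t k • d k)
    (harmijo : ∀ k i,
      (F i (x (k + 1)) - F i (x k)) / αb k i ≤ σ₁ * t k * Dval F (αb k) (x k) (d k))
    (hcurv : ∀ k, σ₂ * Dval F (αb k) (x k) (d k) ≤ Dval F (αb k) (x (k + 1)) (d k))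
    (hdesc : ∀ k, Dval F (αb k) (x k) (d k) ≤ -(c₁ / 2) * ‖d k‖ ^ 2)
    (hbound : ∀ k, Dval F (αb k) (x k) (d k) ≤
      -((Finset.univ.inf' Finset.univ_nonempty fun i => (α k i / αb k i) ^ 2)
          * ‖v k‖ ^ 2 / c₂)) :
    (∃ xstar : EuclideanSpace ℝ (Fin n), ∃ φ : ℕ → ℕ, StrictMono φ ∧
      Tendsto (fun k => x (φ k)) atTop (nhds xstar)) ∧
    (∀ xstar : EuclideanSpace ℝ (Fin n),
      xstar ∈ {y : EuclideanSpace ℝ (Fin n) | ∀ i, F i y ≤ F i (x 0)} →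
      (∃ φ : ℕ → ℕ, StrictMono φ ∧ Tendsto (fun k => x (φ k)) atTop (nhds xstar)) →
      ¬ ∃ dd : EuclideanSpace ℝ (Fin n), ∀ i, ⟪gradient (F i) xstar, dd⟫ < 0) := by
  obtain ⟨ha, hab⟩ := hαminmax
  obtain ⟨hσ1, hσ12, hσ2⟩ := hσ
  obtain ⟨hc1, hc12⟩ := hc
  have hb : 0 < αmax := ha.trans_le hab
  have hc2 : 0 < c₂ := hc1.trans_le hc12
  have hDneg : ∀ k, Dval F (αb k) (x k) (d k) ≤ 0 := fun k => by
    have := hdesc k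
    have h2 : 0 ≤ c₁ / 2 * ‖d k‖ ^ 2 := by positivity
    linarith
  have hbpos : ∀ k i, 0 < αb k i := fun k i => ha.trans_le (hαb k i).1
  have hdec : ∀ k i, F i (x (k + 1)) ≤ F i (x k) := fun k i => by
    have h1 := harmijo k i
    have h2 : σ₁ * t k * Dval F (αb k) (x k) (d k) ≤ 0 :=
      mul_nonpos_of_nonneg_of_nonpos (mul_pos hσ1 (ht k)).le (hDneg k)
    have h3 := h1.trans h2
    rw [div_le_iff₀ (hbpos k i)] at h3
    linarith
  have hanti : ∀ i, Antitone fun k => F i (x k) := fun i =>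
    antitone_nat_of_succ_le fun k => hdec k i
  have hL : ∀ k, x k ∈ {y : EuclideanSpace ℝ (Fin n) | ∀ i, F i y ≤ F i (x 0)} :=
    fun k i => hanti i (Nat.zero_le k)
  have hgc : ∀ i, Continuous (gradient (F i)) := fun i => continuous_grad _ (hF i)
  refine ⟨?_, ?_⟩
  · obtain ⟨y, _, φ, h1, h2⟩ := hlevel.tendsto_subseq hL
    exact ⟨y, φ, h1, h2⟩
  rintro xs - ⟨φ, hφ, hx⟩ ⟨dd, hdd⟩
  -- gradient bound
  obtain ⟨G, hG0, hG⟩ : ∃ G : ℝ, 0 < G ∧ ∀ k i, ‖gradient (F i) (x k)‖ ≤ G := by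
    have hc : Continuous fun y => ∑ i, ‖gradient (F i) y‖ :=
      continuous_finsetSum _ fun i _ => (hgc i).norm
    obtain ⟨G, hG⟩ := hlevel.exists_bound_of_continuousOn hc.continuousOn
    refine ⟨max G 1, by positivity, fun k i => ?_⟩
    have h1 := (le_abs_self _).trans (hG (x k) (hL k))
    have h2 : ‖gradient (F i) (x k)‖ ≤ ∑ i, ‖gradient (F i) (x k)‖ :=
      Finset.single_le_sum (f := fun i => ‖gradient (F i) (x k)‖)
        (fun i _ => norm_nonneg _) (Finset.mem_univ i)
    exact (h2.trans h1).trans (le_max_left _ _)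
  -- direction bound
  obtain ⟨B, hB0, hB⟩ : ∃ B : ℝ, 0 ≤ B ∧ ∀ k, ‖d k‖ ≤ B := by
    refine ⟨2 * G / (αmin * c₁), by positivity, fun k => ?_⟩
    have h1 := Dval_ge F (αb k) (x k) (d k) G αmin ha (fun i => (hαb k i).1) (hG k)
    have h2 := hdesc k
    have h3 : c₁ / 2 * ‖d k‖ ^ 2 ≤ G * ‖d k‖ / αmin := by linarith
    rcases (norm_nonneg (d k)).eq_or_lt with h | h
    · rw [← h]; positivity
    · rw [le_div_iff₀ ha] at h3
      rw [le_div_iff₀ (by positivity)]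
      have : ‖d k‖ * (‖d k‖ * (αmin * c₁)) ≤ ‖d k‖ * (2 * G) := by nlinarith
      exact le_of_mul_le_mul_left this h
  -- t_k D_k → 0
  have htD : Tendsto (fun k => t k * -Dval F (αb k) (x k) (d k)) atTop (𝓝 0) := by
    have hbdd : BddBelow (Set.range fun k => F 0 (x k)) := by
      obtain ⟨C, hC⟩ := hlevel.exists_bound_of_continuousOn (hF 0).continuous.continuousOn
      refine ⟨-C, ?_⟩
      rintro _ ⟨k, rfl⟩
      exact (abs_le.mp (hC (x k) (hL k))).1
    have h1 := tendsto_atTop_ciInf (hanti 0) hbdd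
    have h2 := (h1.sub (h1.comp (tendsto_add_atTop_nat 1))).div_const (αmin * σ₁)
    rw [sub_self, zero_div] at h2
    refine squeeze_zero (fun k => mul_nonneg (ht k).le (neg_nonneg.mpr (hDneg k)))
      (fun k => ?_) h2
    simp only [Function.comp]
    rw [le_div_iff₀ (by positivity)]
    have h3 := harmijo k 0
    rw [div_le_iff₀ (hbpos k 0)] at h3
    have h4 : 0 ≤ σ₁ * (t k * -Dval F (αb k) (x k) (d k)) :=
      mul_nonneg hσ1.le (mul_nonneg (ht k).le (neg_nonneg.mpr (hDneg k)))
    have h5 := mul_le_mul_of_nonneg_left (hαb k 0).1 h4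
    linarith
  -- uniform negativity
  obtain ⟨η, hη0, hη⟩ : ∃ η : ℝ, 0 < η ∧ ∀ i, ⟪gradient (F i) xs, dd⟫ < -η := by
    have : ∀ᶠ η in 𝓝[>] (0 : ℝ), ∀ i, ⟪gradient (F i) xs, dd⟫ < -η := by
      rw [eventually_all]
      intro i
      apply Filter.Eventually.filter_mono nhdsWithin_le_nhds
      have := eventually_lt_nhds (neg_pos.mpr (hdd i))
      filter_upwards [this] with η h
      linarith
    obtain ⟨η, h1, h2⟩ := (this.and self_mem_nhdsWithin).exists
    exact ⟨η, h2, h1⟩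
  have hev : ∀ᶠ k in atTop, ∀ i, ⟪gradient (F i) (x (φ k)), dd⟫ ≤ -η := by
    rw [eventually_all]
    intro i
    have hc : Continuous fun y => ⟪gradient (F i) y, dd⟫ := (hgc i).inner continuous_const
    have := (hc.tendsto xs).comp hx
    filter_upwards [this.eventually_lt_const (hη i)] with k hk using hk.le
  set r := η ^ 2 / (2 * αmax ^ 2 * (‖dd‖ ^ 2 + 1)) * αmin / G with hr
  have hr0 : 0 < r := by positivity
  set ε := (αmin / αmax) ^ 2 * r ^ 2 / c₂ with hε
  have hε0 : 0 < ε := by positivity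
  have hDε : ∀ᶠ k in atTop, ε ≤ -Dval F (αb (φ k)) (x (φ k)) (d (φ k)) := by
    filter_upwards [hev] with k hk
    have h1 := bb_lower F (α (φ k)) (x (φ k)) (v (φ k)) dd G αmin αmax η ha (hα (φ k)) hG0
      (hG (φ k)) (hv (φ k)) hη0 hk
    have h2 := hbound (φ k)
    refine le_trans ?_ (le_neg_of_le_neg h2)
    have h3 : (αmin / αmax) ^ 2 ≤ Finset.univ.inf' Finset.univ_nonempty
        fun i => (α (φ k) i / αb (φ k) i) ^ 2 := by
      apply Finset.le_inf'
      intro i _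
      have h6 : αmin / αmax ≤ α (φ k) i / αb (φ k) i :=
        div_le_div₀ (ha.le.trans (hα _ i).1) (hα _ i).1 (hbpos _ i) (hαb _ i).2
      exact pow_le_pow_left₀ (by positivity) h6 2
    have h4 : r ^ 2 ≤ ‖v (φ k)‖ ^ 2 := pow_le_pow_left₀ hr0.le h1 2
    have h5 := mul_le_mul h3 h4 (by positivity) ((by positivity : (0:ℝ) ≤ (αmin / αmax) ^ 2).trans h3)
    exact div_le_div_of_nonneg_right h5 hc2.le
  -- t along subsequence
  have ht0 : Tendsto (fun k => t (φ k)) atTop (𝓝 0) := by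
    have h1 := (htD.comp hφ.tendsto_atTop).div_const ε
    rw [zero_div] at h1
    refine squeeze_zero' (Eventually.of_forall fun k => (ht _).le) ?_ h1
    filter_upwards [hDε] with k hk
    simp only [Function.comp]
    rw [le_div_iff₀ hε0]
    exact mul_le_mul_of_nonneg_left hk (ht _).le
  have hstep : Tendsto (fun k => t (φ k) • d (φ k)) atTop (𝓝 0) := by
    have h1 := ht0.mul_const B
    rw [zero_mul] at h1
    refine squeeze_zero_norm (fun k => ?_) h1
    rw [norm_smul, Real.norm_eq_abs, abs_of_pos (ht _)]
    exact mul_le_mul_of_nonneg_left (hB _) (ht _).le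
  have hx1 : Tendsto (fun k => x (φ k + 1)) atTop (𝓝 xs) := by
    have := hx.add hstep
    rw [add_zero] at this
    simpa only [hupdate] using this
  have he : Tendsto (fun k => ∑ i, ‖gradient (F i) (x (φ k + 1)) - gradient (F i) (x (φ k))‖)
      atTop (𝓝 0) := by
    have : Tendsto (fun k => ∑ i, ‖gradient (F i) (x (φ k + 1)) - gradient (F i) (x (φ k))‖)
      atTop (𝓝 (∑ i, ‖gradient (F i) xs - gradient (F i) xs‖)) :=
      tendsto_finsetSum _ fun i _ =>
        ((((hgc i).tendsto xs).comp hx1).sub (((hgc i).tendsto xs).comp hx)).norm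
    simpa using this
  have hlim := (he.mul_const B).div_const αmin
  rw [zero_mul, zero_div] at hlim
  have hfin : (1 - σ₂) * ε ≤ 0 := by
    refine ge_of_tendsto hlim ?_
    filter_upwards [hDε] with k hk
    set e := ∑ i, ‖gradient (F i) (x (φ k + 1)) - gradient (F i) (x (φ k))‖ with hedef
    have he0 : 0 ≤ e := Finset.sum_nonneg fun i _ => norm_nonneg _
    have h1 := Dval_diff F (αb (φ k)) (x (φ k)) (x (φ k + 1)) (d (φ k)) e αmin ha
      (fun i => (hαb _ i).1) (fun i =>
        Finset.single_le_sum
          (f := fun i => ‖gradient (F i) (x (φ k + 1)) - gradient (F i) (x (φ k))‖)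
          (fun i _ => norm_nonneg _) (Finset.mem_univ i))
    have h2 := hcurv (φ k)
    have h3 : e * ‖d (φ k)‖ / αmin ≤ e * B / αmin :=
      div_le_div_of_nonneg_right (mul_le_mul_of_nonneg_left (hB _) he0) ha.le
    have h4 := mul_le_mul_of_nonneg_left hk (sub_pos.mpr hσ2).le
    linarith
  have := mul_pos (sub_pos.mpr hσ2) hε0
  linarith
end

section
/- Stepsize lower bound: Suppose each gradient ∇F_i is Lipschitz continuous with constant L_i, and set L_max = max_i L_i. Let x ∈ ℝ^n, d ∈ ℝ^n with d ≠ 0, let ᾱ ∈ ℝ^m satisfy ᾱ_i ≥ α_min > 0 for all i, and suppose D_ᾱ(x,d) ≤ −(c₁/2)‖d‖² with c₁ > 0. If t > 0 satisfies the curvature Wolfe condition D_ᾱ(x+td, d) ≥ σ₂ D_ᾱ(x,d) with 0 < σ₂ < 1, then t ≥ (1 − σ₂) c₁ α_min / (2 L_max). -/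
open RealInnerProductSpace

/-- stepsize lower bound: under Lipschitz continuity of the gradients and the
sufficient descent condition, any stepsize satisfying the curvature Wolfe condition is
bounded below by `(1 − σ₂) c₁ α_min / (2 L_max)`. -/
theorem wolfe_stepsize_lower_bound {n m : ℕ} [NeZero m]
    (F : Fin m → EuclideanSpace ℝ (Fin n) → ℝ)
    (hF : ∀ i, ContDiff ℝ 1 (F i))
    (L : Fin m → ℝ)
    (hL : ∀ i, ∀ y z : EuclideanSpace ℝ (Fin n),
      ‖gradient (F i) y - gradient (F i) z‖ ≤ L i * ‖y - z‖)
    (x d : EuclideanSpace ℝ (Fin n)) (hd : d ≠ 0)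
    (αb : Fin m → ℝ) (αmin : ℝ) (hαmin : 0 < αmin) (hαb : ∀ i, αmin ≤ αb i)
    (c₁ : ℝ) (hc₁ : 0 < c₁)
    (hdesc : Dval F αb x d ≤ -(c₁ / 2) * ‖d‖ ^ 2)
    (t σ₂ : ℝ) (ht : 0 < t) (hσ₂ : 0 < σ₂) (hσ₂' : σ₂ < 1)
    (hcurv : σ₂ * Dval F αb x d ≤ Dval F αb (x + t • d) d) :
    (1 - σ₂) * c₁ * αmin / (2 * Finset.univ.sup' Finset.univ_nonempty L) ≤ t := by
  have hdn : 0 < ‖d‖ ^ 2 := by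
    have := norm_pos_iff.mpr hd
    positivity
  set M := Finset.univ.sup' Finset.univ_nonempty L with hM
  have hLM : ∀ i, L i ≤ M := fun i => Finset.le_sup' L (Finset.mem_univ i)
  have key : ∀ i, ⟪gradient (F i) (x + t • d), d⟫ - ⟪gradient (F i) x, d⟫
      ≤ M * t * ‖d‖ ^ 2 := by
    intro i
    rw [← inner_sub_left]
    have h1 := real_inner_le_norm (gradient (F i) (x + t • d) - gradient (F i) x) d
    have h2 := hL i (x + t • d) x
    rw [add_sub_cancel_left, norm_smul, Real.norm_of_nonneg ht.le] at h2
    have h3 := mul_le_mul_of_nonneg_right h2 (norm_nonneg d)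
    have h4 := mul_le_mul_of_nonneg_right (hLM i) (mul_pos ht hdn).le
    nlinarith
  have hM0 : 0 ≤ M := by
    have h2 := hL 0 (x + d) x
    rw [add_sub_cancel_left] at h2
    have h3 : 0 ≤ L 0 * ‖d‖ := (norm_nonneg _).trans h2
    exact (nonneg_of_mul_nonneg_left h3 (norm_pos_iff.mpr hd)).trans (hLM 0)
  obtain ⟨i, -, hi⟩ := Finset.exists_mem_eq_sup' (Finset.univ_nonempty (α := Fin m))
    (fun i => ⟪gradient (F i) (x + t • d), d⟫ / αb i)
  have hDi : ⟪gradient (F i) x, d⟫ / αb i ≤ Dval F αb x d :=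
    Finset.le_sup' (fun i => ⟪gradient (F i) x, d⟫ / αb i) (Finset.mem_univ i)
  have hDt : Dval F αb (x + t • d) d = ⟪gradient (F i) (x + t • d), d⟫ / αb i := hi
  have hαi : 0 < αb i := hαmin.trans_le (hαb i)
  have h5 : ⟪gradient (F i) (x + t • d), d⟫ / αb i - ⟪gradient (F i) x, d⟫ / αb i
      ≤ M * t * ‖d‖ ^ 2 / αmin := by
    rw [← sub_div]
    exact (div_le_div_of_nonneg_right (key i) hαi.le).trans
      (div_le_div_of_nonneg_left (by positivity) hαmin (hαb i))
  have h6 : (1 - σ₂) * (c₁ / 2 * ‖d‖ ^ 2) ≤ M * t * ‖d‖ ^ 2 / αmin := by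
    have := mul_le_mul_of_nonneg_left hdesc (sub_pos.mpr hσ₂').le
    linarith
  rw [le_div_iff₀ hαmin] at h6
  have h7 : (1 - σ₂) * c₁ * αmin ≤ t * (2 * M) := by
    refine le_of_mul_le_mul_right ?_ hdn
    linarith
  exact div_le_of_le_mul₀ (by positivity) ht.le h7
end

section
/- Q-linear decrease step: Let constants 0 < α_min ≤ α_max, σ₁ > 0, t_min > 0, c₂ > 0, κ > 0 be given. Let x ∈ ℝ^n with u_0(x) finite, let α, ᾱ ∈ [α_min, α_max]^m, let v ∈ ℝ^n, let d ∈ ℝ^n, and let t ≥ t_min. Suppose: (i) (F_i(x+td) − F_i(x))/ᾱ_i ≤ σ₁ t D_ᾱ(x,d) for all i; (ii) D_ᾱ(x,d) ≤ −min_{i}(α_i/ᾱ_i)² ‖v‖²/c₂; and (iii) the error bound u_0(x) ≤ κ‖v‖² holds. Then u_0(x+td) ≤ (1 − r) u_0(x), where r = σ₁ t_min α_min³ / (c₂ κ α_max²). -/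
open RealInnerProductSpace

/-- The merit function `u₀(x) = sup_{z} min_i (F_i(x) − F_i(z))`. -/
noncomputable def u0 {n m : ℕ} [NeZero m] (F : Fin m → EuclideanSpace ℝ (Fin n) → ℝ)
    (x : EuclideanSpace ℝ (Fin n)) : ℝ :=
  ⨆ z : EuclideanSpace ℝ (Fin n),
    Finset.univ.inf' Finset.univ_nonempty fun i => F i x - F i z

/-- Q-linear decrease step: under the Armijo-type decrease, the
Barzilai–Borwein descent bound and the error bound `u₀(x) ≤ κ‖v‖²`, one step decreases the
merit function by the factor `1 − r` with `r = σ₁ t_min α_min³ / (c₂ κ α_max²)`. -/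
theorem q_linear_decrease_step {n m : ℕ} [NeZero m]
    (F : Fin m → EuclideanSpace ℝ (Fin n) → ℝ)
    (hF : ∀ i, ContDiff ℝ 1 (F i))
    (αmin αmax σ₁ tmin c₂ κ : ℝ)
    (hαmin : 0 < αmin) (hαminmax : αmin ≤ αmax)
    (hσ₁ : 0 < σ₁) (htmin : 0 < tmin) (hc₂ : 0 < c₂) (hκ : 0 < κ)
    (x : EuclideanSpace ℝ (Fin n))
    (hfin : BddAbove (Set.range fun z : EuclideanSpace ℝ (Fin n) =>
      Finset.univ.inf' Finset.univ_nonempty fun i => F i x - F i z))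
    (α αb : Fin m → ℝ)
    (hα : ∀ i, α i ∈ Set.Icc αmin αmax) (hαb : ∀ i, αb i ∈ Set.Icc αmin αmax)
    (v d : EuclideanSpace ℝ (Fin n)) (t : ℝ) (ht : tmin ≤ t)
    (harmijo : ∀ i, (F i (x + t • d) - F i x) / αb i ≤ σ₁ * t * Dval F αb x d)
    (hbound : Dval F αb x d ≤
      -((Finset.univ.inf' Finset.univ_nonempty fun i => (α i / αb i) ^ 2) * ‖v‖ ^ 2 / c₂))
    (herr : u0 F x ≤ κ * ‖v‖ ^ 2) :
    u0 F (x + t • d) ≤ (1 - σ₁ * tmin * αmin ^ 3 / (c₂ * κ * αmax ^ 2)) * u0 F x := by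
  have hmax : 0 < αmax := lt_of_lt_of_le hαmin hαminmax
  have hv : 0 ≤ ‖v‖ ^ 2 := by positivity
  have hq : (αmin / αmax) ^ 2 ≤
      Finset.univ.inf' Finset.univ_nonempty fun i => (α i / αb i) ^ 2 := by
    apply Finset.le_inf'
    intro i _
    have h1 := (hα i).1
    have h2 := (hαb i).2
    have h3 : 0 < αb i := lt_of_lt_of_le hαmin (hαb i).1
    have h4 : 0 < α i := lt_of_lt_of_le hαmin h1
    gcongr
  have hD : Dval F αb x d ≤ -((αmin / αmax) ^ 2 * ‖v‖ ^ 2 / c₂) := by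
    refine hbound.trans (neg_le_neg ?_)
    gcongr
  set e : ℝ := (αmin / αmax) ^ 2 * ‖v‖ ^ 2 / c₂ with he
  have he0 : 0 ≤ e := by positivity
  have hstep : ∀ i, F i (x + t • d) ≤ F i x - αmin * (σ₁ * tmin * e) := by
    intro i
    have h3 : 0 < αb i := lt_of_lt_of_le hαmin (hαb i).1
    have ht0 : 0 < t := lt_of_lt_of_le htmin ht
    have h5 : (F i (x + t • d) - F i x) / αb i ≤ -(σ₁ * tmin * e) := by
      have h6 : σ₁ * t * Dval F αb x d ≤ σ₁ * t * (-e) :=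
        mul_le_mul_of_nonneg_left hD (by positivity)
      have h7 : σ₁ * tmin * e ≤ σ₁ * t * e := by gcongr
      linarith [harmijo i]
    rw [div_le_iff₀ h3] at h5
    have h8 : αmin * (σ₁ * tmin * e) ≤ αb i * (σ₁ * tmin * e) :=
      mul_le_mul_of_nonneg_right (hαb i).1 (by positivity)
    linarith
  have hu : u0 F (x + t • d) ≤ u0 F x - αmin * (σ₁ * tmin * e) := by
    refine ciSup_le fun z => ?_
    have h1 : (Finset.univ.inf' Finset.univ_nonempty fun i => F i x - F i z) ≤ u0 F x :=
      le_ciSup hfin z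
    have h2 : (Finset.univ.inf' Finset.univ_nonempty fun i => F i (x + t • d) - F i z)
        + αmin * (σ₁ * tmin * e)
        ≤ Finset.univ.inf' Finset.univ_nonempty fun i => F i x - F i z := by
      apply Finset.le_inf'
      intro i hi
      have h3 := Finset.inf'_le (fun i => F i (x + t • d) - F i z) hi
      have h4 := hstep i
      linarith
    linarith
  have hr : σ₁ * tmin * αmin ^ 3 / (c₂ * κ * αmax ^ 2) * u0 F x ≤ αmin * (σ₁ * tmin * e) := by
    calc _ ≤ σ₁ * tmin * αmin ^ 3 / (c₂ * κ * αmax ^ 2) * (κ * ‖v‖ ^ 2) := by gcongr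
      _ = _ := by rw [he]; field_simp
  linarith
end
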